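/- arXiv:1512.00365 — 5 statements merged into one kernel-verified Lean document; each statement's English description precedes it below -/
import Mathlib

section
/- Let P be a finite nonempty ranked poset with an n-dimensional lattice projection π. Let v = (v_1,…,v_n) and w = (w_1,…,w_n) with each v_j, w_j ∈ {−1,1}, and let σ : supp(P,π,v) → supp(P,π,v) and τ : supp(P,π,w) → supp(P,π,w) be bijections. Then there is an equivariant bijection between J(P) under Pro^σ_{π,v} and J(P) under Pro^τ_{π,w}; that is, there exists a bijection φ : J(P) → J(P) with φ ∘ Pro^σ_{π,v} = Pro^τ_{π,w} ∘ φ. -/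
/-- The simultaneous toggle of all elements of `S`: an element of `S` is removed
from `I` if its removal leaves an order ideal, and added to `I` if its addition
yields an order ideal.  For order ideals this agrees with the composition, in
any order, of the individual toggles `t_x` for `x ∈ S`, whenever those toggles
pairwise commute (as they do for the elements of an affine hyperplane). -/
def hyperTog {P : Type*} [PartialOrder P] (S : Set P) (I : Set P) : Set P :=
  {x | (x ∈ I ∧ ¬ (x ∈ S ∧ IsLowerSet (I \ {x}))) ∨
       (x ∉ I ∧ x ∈ S ∧ IsLowerSet (I ∪ {x}))}

/-- The affine hyperplane `{x ∈ P : ⟨π(x), v⟩ = i}`. -/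
def hplaneSet {P : Type*} {n : ℕ} (π : P → Fin n → ℤ) (v : Fin n → ℤ) (i : ℤ) :
    Set P := {x | (∑ j, π x j * v j) = i}

/-- Promotion with respect to `π`, `v` and a bijection `σ` of the support
`[a,b]`: the composition `T^{σ(a)} ∘ T^{σ(a+1)} ∘ ⋯ ∘ T^{σ(b)}` of hyperplane
toggles (rightmost factor applied first). -/
def proSigma {P : Type*} [PartialOrder P] {n : ℕ} (π : P → Fin n → ℤ)
    (v : Fin n → ℤ) (a b : ℤ) (σ : ℤ → ℤ) : Set P → Set P :=
  (((List.range (b + 1 - a).toNat).map fun k => σ (a + (k : ℤ))).foldr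
    (fun i f => hyperTog (hplaneSet π v i) ∘ f) id)

/-- A set containing no two elements in a covering relation. -/
def CoverFree {P : Type*} [PartialOrder P] (S : Set P) : Prop :=
  ∀ x ∈ S, ∀ y ∈ S, ¬ x ⋖ y

theorem isLowerSet_of_covBy {P : Type*} [Finite P] [PartialOrder P] {I : Set P}
    (h : ∀ x y : P, x ⋖ y → y ∈ I → x ∈ I) : IsLowerSet I := by
  classical
  have := Fintype.ofFinite P
  let _ : LocallyFiniteOrder P := Fintype.toLocallyFiniteOrder
  intro y x hxy hy
  have := le_iff_reflTransGen_covBy.1 hxy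
  induction this using Relation.ReflTransGen.head_induction_on with
  | refl => exact hy
  | head h1 h2 ih => exact h _ _ h1 (ih (le_iff_reflTransGen_covBy.2 h2))

theorem mem_hyperTog_of_notMem {P : Type*} [PartialOrder P] {S I : Set P} {x : P}
    (hx : x ∉ S) : x ∈ hyperTog S I ↔ x ∈ I := by
  simp [hyperTog, hx]

theorem mem_hyperTog_of_mem {P : Type*} [Finite P] [PartialOrder P] {S I : Set P} {x : P}
    (hI : IsLowerSet I) (hx : x ∈ S) :
    x ∈ hyperTog S I ↔ (∀ y, y ⋖ x → y ∈ I) ∧ (x ∈ I → ∃ y, x ⋖ y ∧ y ∈ I) := by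
  by_cases hxI : x ∈ I
  · have h1 : IsLowerSet (I \ {x}) ↔ ∀ y, x ⋖ y → y ∉ I := by
      constructor
      · intro h y hxy hy
        exact (h hxy.le ⟨hy, hxy.lt.ne'⟩).2 rfl
      · intro h
        apply isLowerSet_of_covBy
        rintro a b hab ⟨hb, hbx⟩
        refine ⟨hI hab.le hb, ?_⟩
        rintro rfl
        exact h b hab hb
    have h2 : ∀ y, y ⋖ x → y ∈ I := fun y hy => hI hy.le hxI
    simp only [hyperTog, Set.mem_ofPred_eq, hxI, hx, h1, true_and, not_true, false_and, or_false]
    push Not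
    exact ⟨fun h => ⟨h2, fun _ => h⟩, fun h => h.2 trivial⟩
  · have h1 : IsLowerSet (I ∪ {x}) ↔ ∀ y, y ⋖ x → y ∈ I := by
      constructor
      · intro h y hy
        rcases h hy.le (Or.inr rfl) with h | h
        · exact h
        · exact absurd h hy.lt.ne
      · intro h
        apply isLowerSet_of_covBy
        rintro a b hab (hb | rfl)
        · exact Or.inl (hI hab.le hb)
        · exact Or.inl (h a hab)
    rw [Set.union_singleton] at h1
    simp [hyperTog, hxI, hx, h1]

theorem hyperTog_lower {P : Type*} [Finite P] [PartialOrder P] {S I : Set P}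
    (hS : CoverFree S) (hI : IsLowerSet I) : IsLowerSet (hyperTog S I) := by
  apply isLowerSet_of_covBy
  intro x y hxy hy
  by_cases hxS : x ∈ S
  · have hyS : y ∉ S := fun h => hS x hxS y h hxy
    rw [mem_hyperTog_of_notMem hyS] at hy
    rw [mem_hyperTog_of_mem hI hxS]
    exact ⟨fun z hz => hI (hz.le.trans hxy.le) hy, fun _ => ⟨y, hxy, hy⟩⟩
  · rw [mem_hyperTog_of_notMem hxS]
    by_cases hyS : y ∈ S
    · rw [mem_hyperTog_of_mem hI hyS] at hy
      exact hy.1 x hxy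
    · rw [mem_hyperTog_of_notMem hyS] at hy
      exact hI hxy.le hy

theorem hyperTog_union {P : Type*} [Finite P] [PartialOrder P] {S S' I : Set P}
    (hS : CoverFree (S ∪ S')) (hd : Disjoint S S') (hI : IsLowerSet I) :
    hyperTog S (hyperTog S' I) = hyperTog (S ∪ S') I := by
  have hS' : CoverFree S' := fun x hx y hy => hS x (Or.inr hx) y (Or.inr hy)
  have hI' := hyperTog_lower hS' hI
  ext x
  by_cases hx : x ∈ S
  · have hx' : x ∉ S' := fun h => Set.disjoint_left.1 hd hx h
    rw [mem_hyperTog_of_mem hI' hx, mem_hyperTog_of_mem hI (Set.mem_union_left S' hx),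
      mem_hyperTog_of_notMem hx']
    have h1 : ∀ y, y ⋖ x → (y ∈ hyperTog S' I ↔ y ∈ I) := fun y hy =>
      mem_hyperTog_of_notMem (fun h => hS y (Or.inr h) x (Or.inl hx) hy)
    have h2 : ∀ y, x ⋖ y → (y ∈ hyperTog S' I ↔ y ∈ I) := fun y hy =>
      mem_hyperTog_of_notMem (fun h => hS x (Or.inl hx) y (Or.inr h) hy)
    constructor
    · rintro ⟨p, q⟩
      exact ⟨fun y hy => (h1 y hy).1 (p y hy), fun h => by
        obtain ⟨y, a, b⟩ := q h
        exact ⟨y, a, (h2 y a).1 b⟩⟩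
    · rintro ⟨p, q⟩
      exact ⟨fun y hy => (h1 y hy).2 (p y hy), fun h => by
        obtain ⟨y, a, b⟩ := q h
        exact ⟨y, a, (h2 y a).2 b⟩⟩
  · rw [mem_hyperTog_of_notMem hx]
    by_cases hx' : x ∈ S'
    · rw [mem_hyperTog_of_mem hI hx', mem_hyperTog_of_mem hI (Set.mem_union_right S hx')]
    · rw [mem_hyperTog_of_notMem hx', mem_hyperTog_of_notMem (by simp [hx, hx'])]

theorem hyperTog_invol {P : Type*} [Finite P] [PartialOrder P] {S I : Set P}
    (hS : CoverFree S) (hI : IsLowerSet I) : hyperTog S (hyperTog S I) = I := by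
  have hI' := hyperTog_lower hS hI
  ext x
  by_cases hx : x ∈ S
  · have h1 : ∀ y, y ⋖ x → (y ∈ hyperTog S I ↔ y ∈ I) := fun y hy =>
      mem_hyperTog_of_notMem (fun h => hS y h x hx hy)
    have h2 : ∀ y, x ⋖ y → (y ∈ hyperTog S I ↔ y ∈ I) := fun y hy =>
      mem_hyperTog_of_notMem (fun h => hS x hx y h hy)
    rw [mem_hyperTog_of_mem hI' hx]
    constructor
    · rintro ⟨p, q⟩
      by_contra hxI
      obtain ⟨y, a, b⟩ := q ((mem_hyperTog_of_mem hI hx).2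
        ⟨fun y hy => (h1 y hy).1 (p y hy), fun h => absurd h hxI⟩)
      exact hxI (hI a.le ((h2 y a).1 b))
    · intro hxI
      refine ⟨fun y hy => (h1 y hy).2 (hI hy.le hxI), fun h => ?_⟩
      obtain ⟨y, a, b⟩ := ((mem_hyperTog_of_mem hI hx).1 h).2 hxI
      exact ⟨y, a, (h2 y a).2 b⟩
  · rw [mem_hyperTog_of_notMem hx, mem_hyperTog_of_notMem hx]

/-- The simultaneous toggle as a permutation of the order ideals. -/
def togPerm {P : Type*} [Finite P] [PartialOrder P] (S : Set P) (hS : CoverFree S) :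
    Equiv.Perm {I : Set P // IsLowerSet I} :=
  Function.Involutive.toPerm (fun I => ⟨hyperTog S I.1, hyperTog_lower hS I.2⟩)
    (fun I => Subtype.ext (hyperTog_invol hS I.2))

theorem togPerm_coe {P : Type*} [Finite P] [PartialOrder P] (S : Set P) (hS : CoverFree S)
    (I : {I : Set P // IsLowerSet I}) : (togPerm S hS I).1 = hyperTog S I.1 := rfl

/-- Reduction step: fusing the top generator into its neighbour. -/
theorem fuse_step {G : Type*} [Group G] (a : ℤ) (m : ℕ) (T : ℤ → G)
    (hT : ∀ i k : ℤ, k < a + (m + 1 : ℕ) → i + 2 ≤ k → Commute (T i) (T k))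
    (L : List ℤ) (hn : L.Nodup) (hm : ∀ i, i ∈ L ↔ a ≤ i ∧ i < a + (m + 1 : ℕ)) (h0 : m ≠ 0) :
    ∃ W : List ℤ, W.Nodup ∧ (∀ i, i ∈ W ↔ a ≤ i ∧ i < a + (m : ℕ)) ∧
      IsConj (L.map T).prod
        (W.map (Function.update T (a + m - 1) (T (a + m) * T (a + m - 1)))).prod := by
  have hb : a + m ∈ L := (hm _).2 ⟨by omega, by push_cast; omega⟩
  obtain ⟨A, B, rfl⟩ := List.append_of_mem hb
  have hp : (A ++ (a + m) :: B).Perm ((a + m) :: (B ++ A)) :=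
    List.perm_append_comm.trans (by simp)
  have hn2 := hp.nodup_iff.1 hn
  rw [List.nodup_cons] at hn2
  have hmW : ∀ i, i ∈ B ++ A ↔ a ≤ i ∧ i < a + (m : ℕ) := by
    intro i
    have h1 := hm i
    rw [hp.mem_iff, List.mem_cons] at h1
    constructor
    · intro h
      have h2 := h1.1 (Or.inr h)
      have : i ≠ a + m := by rintro rfl; exact hn2.1 h
      push_cast at h2
      omega
    · intro h
      rcases h1.2 ⟨h.1, by push_cast; omega⟩ with h3 | h3
      · omega
      · exact h3
  refine ⟨B ++ A, hn2.2, hmW, ?_⟩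
  have hc : IsConj ((A ++ (a + m) :: B).map T).prod (T (a + m) * ((B ++ A).map T).prod) := by
    rw [isConj_iff]
    refine ⟨((A.map T).prod)⁻¹, ?_⟩
    simp only [List.map_append, List.map_cons, List.prod_append, List.prod_cons]
    group
  have he : T (a + m) * ((B ++ A).map T).prod =
      ((B ++ A).map (Function.update T (a + m - 1) (T (a + m) * T (a + m - 1)))).prod := by
    have hb2 : a + m - 1 ∈ B ++ A := (hmW _).2 ⟨by omega, by omega⟩
    obtain ⟨U, V, hUV⟩ := List.append_of_mem hb2
    rw [hUV] at hn2 hmW ⊢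
    have hnd := hn2.2
    have hnd' := (List.perm_middle (l₁ := U) (l₂ := V) (a := a + m - 1)).nodup_iff.1 hnd
    rw [List.nodup_cons, List.mem_append, not_or] at hnd'
    have hU : U.map (Function.update T (a + m - 1) (T (a + m) * T (a + m - 1))) = U.map T := by
      apply List.map_congr_left
      intro i hi
      rw [Function.update_of_ne]
      rintro rfl
      exact hnd'.1.1 hi
    have hV : V.map (Function.update T (a + m - 1) (T (a + m) * T (a + m - 1))) = V.map T := by
      apply List.map_congr_left
      intro i hi
      rw [Function.update_of_ne]
      rintro rfl
      exact hnd'.1.2 hi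
    have hcm : Commute (T (a + m)) (U.map T).prod := by
      apply Commute.list_prod_right
      intro x hx
      obtain ⟨i, hi, rfl⟩ := List.mem_map.1 hx
      have h3 := (hmW i).1 (by simp [hi])
      have h4 : i ≠ a + m - 1 := by
        rintro rfl
        exact hnd'.1.1 hi
      exact (hT i (a + m) (by push_cast; omega) (by omega)).symm
    simp only [List.map_append, List.map_cons, List.prod_append, List.prod_cons, hU, hV,
      Function.update_self]
    rw [← mul_assoc, hcm.eq]
    simp only [mul_assoc]
  rw [← he]
  exact hc

theorem path_conj {G : Type*} [Group G] (a : ℤ) (m : ℕ) : ∀ (T : ℤ → G),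
    (∀ i k : ℤ, k < a + (m : ℕ) → i + 2 ≤ k → Commute (T i) (T k)) →
    ∀ L L' : List ℤ, L.Nodup → (∀ i, i ∈ L ↔ a ≤ i ∧ i < a + (m : ℕ)) →
      L'.Nodup → (∀ i, i ∈ L' ↔ a ≤ i ∧ i < a + (m : ℕ)) →
      IsConj (L.map T).prod (L'.map T).prod := by
  induction m with
  | zero =>
    intro T _ L L' _ hm _ hm'
    have h1 : L = [] := List.eq_nil_iff_forall_not_mem.2 fun i hi => by
      have := (hm i).1 hi
      push_cast at this
      omega
    have h2 : L' = [] := List.eq_nil_iff_forall_not_mem.2 fun i hi => by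
      have := (hm' i).1 hi
      push_cast at this
      omega
    rw [h1, h2]
  | succ m ih =>
    intro T hT L L' hn hm hn' hm'
    by_cases h0 : m = 0
    · subst h0
      have hp : L.Perm [a] := (List.perm_ext_iff_of_nodup hn (by simp)).2 fun i => by
        rw [hm i]; simp; omega
      have hp' : L'.Perm [a] := (List.perm_ext_iff_of_nodup hn' (by simp)).2 fun i => by
        rw [hm' i]; simp; omega
      rw [List.perm_singleton.1 hp, List.perm_singleton.1 hp']
    · obtain ⟨W, h1, h2, h3⟩ := fuse_step a m T hT L hn hm h0
      obtain ⟨W', h1', h2', h3'⟩ := fuse_step a m T hT L' hn' hm' h0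
      refine (h3.trans (ih _ ?_ W W' h1 h2 h1' h2')).trans h3'.symm
      intro i k hk hik
      rw [Function.update_of_ne (by omega : i ≠ a + m - 1)]
      by_cases hkb : k = a + m - 1
      · subst hkb
        rw [Function.update_self]
        exact (hT _ _ (by push_cast; omega) (by omega)).mul_right
          (hT _ _ (by push_cast; omega) (by omega))
      · rw [Function.update_of_ne hkb]
        exact hT _ _ (by push_cast; omega) hik

theorem foldr_eq_prod {P : Type*} [Finite P] [PartialOrder P] (H : ℤ → Set P)
    (hH : ∀ i, CoverFree (H i)) (l : List ℤ) (I : {I : Set P // IsLowerSet I}) :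
    (l.foldr (fun i f => hyperTog (H i) ∘ f) id) I.1 =
      ((l.map fun i => togPerm (H i) (hH i)).prod I).1 := by
  induction l with
  | nil => simp
  | cons i l ih =>
    simp only [List.foldr_cons, Function.comp_apply, List.map_cons, List.prod_cons,
      Equiv.Perm.mul_apply, togPerm_coe, ih]

theorem hyperTog_empty {P : Type*} [PartialOrder P] (I : Set P) : hyperTog ∅ I = I := by
  ext x
  exact mem_hyperTog_of_notMem (by simp)

/-- A product of hyperplane toggles whose union is cover-free is one simultaneous toggle. -/
theorem prod_eq_union {P : Type*} [Finite P] [PartialOrder P] (H : ℤ → Set P)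
    (hH : ∀ i, CoverFree (H i)) (hd : ∀ i k, i ≠ k → Disjoint (H i) (H k))
    (l : List ℤ) (hn : l.Nodup) (hl : CoverFree {x | ∃ i ∈ l, x ∈ H i})
    (I : {I : Set P // IsLowerSet I}) :
    ((l.map fun i => togPerm (H i) (hH i)).prod I).1 = hyperTog {x | ∃ i ∈ l, x ∈ H i} I.1 := by
  induction l with
  | nil => simp [hyperTog_empty]
  | cons i l ih =>
    have he : {x | ∃ k ∈ i :: l, x ∈ H k} = H i ∪ {x | ∃ k ∈ l, x ∈ H k} := by
      ext x
      simp
    rw [List.nodup_cons] at hn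
    rw [he] at hl ⊢
    rw [← hyperTog_union hl _ I.2, ← ih hn.2 (fun x hx y hy => hl x (Or.inr hx) y (Or.inr hy))]
    · simp [togPerm_coe]
    · rw [Set.disjoint_left]
      rintro x hx ⟨k, hk, hxk⟩
      exact Set.disjoint_left.1 (hd i k (by rintro rfl; exact hn.1 hk)) hx hxk

theorem ip_parity {n : ℕ} (v p : Fin n → ℤ) (hv : ∀ j, v j = 1 ∨ v j = -1) :
    (2 : ℤ) ∣ (∑ j, p j * v j) - ∑ j, p j := by
  rw [← Finset.sum_sub_distrib]
  apply Finset.dvd_sum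
  intro j _
  rcases hv j with h | h <;> rw [h] <;> omega

theorem ip_cover {n : ℕ} (v p q : Fin n → ℤ) (hv : ∀ j, v j = 1 ∨ v j = -1)
    (hpq : p ≤ q) (h1 : (∑ j, q j) = (∑ j, p j) + 1) :
    (∑ j, q j * v j) = (∑ j, p j * v j) + 1 ∨ (∑ j, p j * v j) = (∑ j, q j * v j) + 1 := by
  have hp := ip_parity v p hv
  have hq := ip_parity v q hv
  have h2 : (∑ j, q j * v j) - (∑ j, p j * v j) ≤ (∑ j, q j) - ∑ j, p j := by
    rw [← Finset.sum_sub_distrib, ← Finset.sum_sub_distrib]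
    apply Finset.sum_le_sum
    intro j _
    have : p j ≤ q j := hpq j
    rcases hv j with h | h <;> rw [h] <;> omega
  have h3 : (∑ j, p j * v j) - (∑ j, q j * v j) ≤ (∑ j, q j) - ∑ j, p j := by
    rw [← Finset.sum_sub_distrib, ← Finset.sum_sub_distrib]
    apply Finset.sum_le_sum
    intro j _
    have : p j ≤ q j := hpq j
    rcases hv j with h | h <;> rw [h] <;> omega
  omega

theorem parity_coverFree {P : Type*} [PartialOrder P] (rk : P → ℤ)
    (hrk : ∀ x y : P, x ⋖ y → rk y = rk x + 1) (r : ℤ) :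
    CoverFree {x | rk x % 2 = r} := by
  intro x hx y hy hxy
  have := hrk x y hxy
  simp only [Set.mem_ofPred_eq] at hx hy
  omega

/-- Every promotion is conjugate to rank-parity toggling (gyration). -/
theorem promotion_conj (P : Type*) [Fintype P] [PartialOrder P]
    (n : ℕ) (π : P → Fin n → ℤ) (rk : P → ℤ)
    (hmono : Monotone π)
    (hrk : ∀ x y : P, x ⋖ y → rk y = rk x + 1)
    (hsum : ∀ x : P, (∑ j, π x j) = rk x)
    (v : Fin n → ℤ) (hv : ∀ j, v j = 1 ∨ v j = -1)
    (a b : ℤ)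
    (hout : ∀ i : ℤ, (i < a ∨ b < i) →
      ∀ I : Set P, IsLowerSet I → hyperTog (hplaneSet π v i) I = I)
    (σ : ℤ → ℤ) (hσ : Set.BijOn σ (Set.Icc a b) (Set.Icc a b)) :
    ∃ A : Equiv.Perm {I : Set P // IsLowerSet I},
      (∀ I, (A I).1 = proSigma π v a b σ I.1) ∧
      IsConj A (togPerm _ (parity_coverFree rk hrk 0) * togPerm _ (parity_coverFree rk hrk 1)) := by
  classical
  have hcov : ∀ x y : P, x ⋖ y → (∑ j, π y j * v j) = (∑ j, π x j * v j) + 1 ∨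
      (∑ j, π x j * v j) = (∑ j, π y j * v j) + 1 := fun x y hxy =>
    ip_cover v (π x) (π y) hv (hmono hxy.le) (by rw [hsum, hsum, hrk x y hxy])
  have hpar : ∀ x : P, (∑ j, π x j * v j) % 2 = rk x % 2 := fun x => by
    have := ip_parity v (π x) hv
    rw [hsum] at this
    omega
  have hH : ∀ i, CoverFree (hplaneSet π v i) := by
    intro i x hx y hy hxy
    have := hcov x y hxy
    simp only [hplaneSet, Set.mem_ofPred_eq] at hx hy
    omega
  have hd : ∀ i k, i ≠ k → Disjoint (hplaneSet π v i) (hplaneSet π v k) := by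
    intro i k hik
    rw [Set.disjoint_left]
    intro x hx hy
    exact hik (Eq.trans (Eq.symm hx) hy)
  have hin : ∀ x : P, a ≤ (∑ j, π x j * v j) ∧ (∑ j, π x j * v j) ≤ b := by
    intro x
    by_contra hcon
    have h1 := hout (∑ j, π x j * v j) (by omega) (Set.Iio x) (isLowerSet_Iio x)
    have h2 : x ∈ hyperTog (hplaneSet π v (∑ j, π x j * v j)) (Set.Iio x) :=
      (mem_hyperTog_of_mem (isLowerSet_Iio x) (show x ∈ hplaneSet π v _ from rfl)).2
        ⟨fun y hy => hy.lt, fun h => absurd h (lt_irrefl x)⟩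
    rw [h1] at h2
    exact lt_irrefl x h2
  set T : ℤ → Equiv.Perm {I : Set P // IsLowerSet I} :=
    fun i => togPerm (hplaneSet π v i) (hH i) with hTdef
  have hcomm : ∀ i k : ℤ, i + 2 ≤ k → Commute (T i) (T k) := by
    intro i k hik
    have hcf : CoverFree (hplaneSet π v i ∪ hplaneSet π v k) := by
      intro x hx y hy hxy
      have := hcov x y hxy
      simp only [hplaneSet, Set.mem_ofPred_eq, Set.mem_union] at hx hy
      omega
    apply Equiv.ext
    intro I
    apply Subtype.ext
    simp only [hTdef, Equiv.Perm.mul_apply, togPerm_coe]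
    rw [hyperTog_union hcf (hd i k (by omega)) I.2,
      hyperTog_union (Set.union_comm _ _ ▸ hcf) (hd k i (by omega)) I.2, Set.union_comm]
  set N : ℕ := (b + 1 - a).toNat with hN
  set L : List ℤ := (List.range N).map fun k : ℕ => σ (a + (k : ℤ)) with hL
  set L0 : List ℤ := (List.range N).map fun k : ℕ => a + (k : ℤ) with hL0
  have hm0 : ∀ i, i ∈ L0 ↔ a ≤ i ∧ i < a + (N : ℕ) := by
    intro i
    simp only [hL0, List.mem_map, List.mem_range]
    constructor
    · rintro ⟨k, hk, rfl⟩
      omega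
    · intro h
      exact ⟨(i - a).toNat, by omega, by omega⟩
  have hn0 : L0.Nodup := by
    apply List.Nodup.map _ List.nodup_range
    intro x y hxy
    simpa using hxy
  have hLL : L = L0.map σ := by simp [hL, hL0, Function.comp_def]
  have hIcc : ∀ i, i ∈ L0 ↔ i ∈ Set.Icc a b := by
    intro i
    rw [hm0, Set.mem_Icc]
    omega
  have hn : L.Nodup := by
    rw [hLL]
    exact List.Nodup.map_on (fun x hx y hy h => hσ.injOn ((hIcc x).1 hx) ((hIcc y).1 hy) h) hn0
  have hm : ∀ i, i ∈ L ↔ a ≤ i ∧ i < a + (N : ℕ) := by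
    intro i
    rw [← hm0, hLL, List.mem_map]
    constructor
    · rintro ⟨k, hk, rfl⟩
      exact (hIcc _).2 (hσ.mapsTo ((hIcc k).1 hk))
    · intro h
      obtain ⟨k, hk, rfl⟩ := hσ.surjOn ((hIcc i).1 h)
      exact ⟨k, (hIcc k).2 hk, rfl⟩
  set E : List ℤ := L0.filter fun i => decide (i % 2 = 0) with hE
  set O : List ℤ := L0.filter fun i => decide (i % 2 = 1) with hO
  have hn' : (E ++ O).Nodup := by
    rw [List.nodup_append']
    refine ⟨hn0.filter _, hn0.filter _, ?_⟩
    intro i hi hi'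
    simp only [hE, hO, List.mem_filter, decide_eq_true_eq] at hi hi'
    omega
  have hm' : ∀ i, i ∈ E ++ O ↔ a ≤ i ∧ i < a + (N : ℕ) := by
    intro i
    rw [← hm0]
    simp only [hE, hO, List.mem_append, List.mem_filter, decide_eq_true_eq]
    have : i % 2 = 0 ∨ i % 2 = 1 := by omega
    tauto
  have hset : ∀ r : ℤ, {x : P | ∃ i ∈ L0.filter (fun i => decide (i % 2 = r)),
      x ∈ hplaneSet π v i} = {x | rk x % 2 = r} := by
    intro r
    ext x
    simp only [List.mem_filter, decide_eq_true_eq, Set.mem_ofPred_eq, hplaneSet]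
    constructor
    · rintro ⟨i, ⟨_, hi⟩, hx⟩
      rw [← hpar, hx, hi]
    · intro h
      exact ⟨_, ⟨(hIcc _).2 (hin x), by rw [hpar, h]⟩, rfl⟩
  have hprod : ∀ r : ℤ, ((L0.filter (fun i => decide (i % 2 = r))).map T).prod =
      togPerm _ (parity_coverFree rk hrk r) := by
    intro r
    apply Equiv.ext
    intro I
    apply Subtype.ext
    rw [togPerm_coe, prod_eq_union _ hH hd _ (hn0.filter _)
      (by rw [hset]; exact parity_coverFree rk hrk r), hset]
  have hpro : proSigma π v a b σ =
      L.foldr (fun i f => hyperTog (hplaneSet π v i) ∘ f) id := by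
    unfold proSigma
    congr 1
    simp [hL, hN, Function.comp_def, List.map_flatMap, List.flatMap_singleton', ← List.map_eq_flatMap]
  refine ⟨(L.map T).prod, fun I => by rw [hpro]; exact (foldr_eq_prod _ hH L I).symm, ?_⟩
  have := path_conj a N T (fun i k _ h => hcomm i k h) L (E ++ O) hn hm hn' hm'
  rw [List.map_append, List.prod_append, hE, hO, hprod, hprod] at this
  exact this

/-- Theorem 3.10: for a finite (nonempty) ranked poset `P` with an
`n`-dimensional lattice projection `π`, vectors `v, w ∈ {±1}ⁿ`, and bijections
`σ`, `τ` of the supports `[av, bv] = supp(P,π,v)` and `[aw, bw] = supp(P,π,w)`,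
there is an equivariant bijection between `J(P)` under `Pro^σ_{π,v}` and `J(P)`
under `Pro^τ_{π,w}`. -/
theorem equivariant_promotions (P : Type*) [Fintype P] [PartialOrder P]
    [Nonempty P] (n : ℕ) (π : P → Fin n → ℤ) (rk : P → ℤ)
    (hmono : Monotone π)
    (hrk : ∀ x y : P, x ⋖ y → rk y = rk x + 1)
    (hsum : ∀ x : P, (∑ j, π x j) = rk x)
    (v w : Fin n → ℤ)
    (hv : ∀ j, v j = 1 ∨ v j = -1) (hw : ∀ j, w j = 1 ∨ w j = -1)
    (av bv aw bw : ℤ) (hvab : av ≤ bv) (hwab : aw ≤ bw)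
    -- `[av, bv]` is the support of `(P, π, v)` :
    (houtv : ∀ i : ℤ, (i < av ∨ bv < i) →
      ∀ I : Set P, IsLowerSet I → hyperTog (hplaneSet π v i) I = I)
    (hendva : ¬ ∀ I : Set P, IsLowerSet I → hyperTog (hplaneSet π v av) I = I)
    (hendvb : ¬ ∀ I : Set P, IsLowerSet I → hyperTog (hplaneSet π v bv) I = I)
    -- `[aw, bw]` is the support of `(P, π, w)` :
    (houtw : ∀ i : ℤ, (i < aw ∨ bw < i) →
      ∀ I : Set P, IsLowerSet I → hyperTog (hplaneSet π w i) I = I)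
    (hendwa : ¬ ∀ I : Set P, IsLowerSet I → hyperTog (hplaneSet π w aw) I = I)
    (hendwb : ¬ ∀ I : Set P, IsLowerSet I → hyperTog (hplaneSet π w bw) I = I)
    (σ τ : ℤ → ℤ)
    (hσ : Set.BijOn σ (Set.Icc av bv) (Set.Icc av bv))
    (hτ : Set.BijOn τ (Set.Icc aw bw) (Set.Icc aw bw)) :
    ∃ φ : Set P → Set P,
      Set.BijOn φ {I : Set P | IsLowerSet I} {I : Set P | IsLowerSet I} ∧
      ∀ I : Set P, IsLowerSet I →
        φ (proSigma π v av bv σ I) = proSigma π w aw bw τ (φ I) := by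
  classical
  obtain ⟨A, hA, cA⟩ := promotion_conj P n π rk hmono hrk hsum v hv av bv houtv σ hσ
  obtain ⟨B, hB, cB⟩ := promotion_conj P n π rk hmono hrk hsum w hw aw bw houtw τ hτ
  obtain ⟨c, hc⟩ := isConj_iff.1 (cA.trans cB.symm)
  have hc' : c * A = B * c := by rw [← hc]; group
  have key : ∀ (I : Set P) (h : IsLowerSet I),
      (if h : IsLowerSet I then (c ⟨I, h⟩).1 else I) = (c ⟨I, h⟩).1 := fun I h => dif_pos h
  refine ⟨fun I => if h : IsLowerSet I then (c ⟨I, h⟩).1 else I, ⟨?_, ?_, ?_⟩, ?_⟩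
  · intro I hI
    simp only [key I hI]
    exact (c ⟨I, hI⟩).2
  · intro I hI J hJ h
    simp only [key I hI, key J hJ] at h
    exact congrArg Subtype.val (c.injective (Subtype.ext h))
  · intro J hJ
    refine ⟨(c.symm ⟨J, hJ⟩).1, (c.symm ⟨J, hJ⟩).2, ?_⟩
    refine (key _ (c.symm ⟨J, hJ⟩).2).trans ?_
    simp only [Subtype.coe_eta, Equiv.apply_symm_apply]
  · intro I hI
    have h1 := hA ⟨I, hI⟩
    have h2 := hB (c ⟨I, hI⟩)
    have h3 := congrArg Subtype.val (DFunLike.congr_fun hc' ⟨I, hI⟩)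
    simp only [Equiv.Perm.mul_apply] at h3
    simp only [← h1, key I hI, key _ (A ⟨I, hI⟩).2, Subtype.coe_eta, ← h2]
    exact h3
end

section
/- For all positive integers a, b, c, the map Ψ₃ : J(𝐚×𝐛×𝐜) → Inc^{a+b+c−1}(a×b), sending an order ideal I to the tableau whose entry in row i and column j (1 ≤ i ≤ a, 1 ≤ j ≤ b) is #{k ∈ {0,…,c−1} : (a−i, b−j, k) ∈ I} + i + j − 1, is a well-defined bijection from the set of order ideals of Fin a × Fin b × Fin c onto the set of increasing tableaux of rectangular shape a×b with entries at most a+b+c−1. -/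
open scoped Classical

/-- Two cells of `ℕ × ℕ` are horizontally or vertically adjacent. -/
def incAdj (c d : ℕ × ℕ) : Prop :=
  (c.1 = d.1 ∧ (c.2 + 1 = d.2 ∨ d.2 + 1 = c.2)) ∨
  (c.2 = d.2 ∧ (c.1 + 1 = d.1 ∨ d.1 + 1 = c.1))

/-- `T` is an increasing tableau on the cell set `μ` with entries in `{1,…,q}`:
entries strictly increase along rows and down columns. -/
def IsIncTab (μ : Finset (ℕ × ℕ)) (q : ℕ) (T : ℕ × ℕ → ℕ) : Prop :=
  (∀ c ∈ μ, 1 ≤ T c ∧ T c ≤ q) ∧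
  (∀ c ∈ μ, ∀ d ∈ μ, c.1 = d.1 → c.2 < d.2 → T c < T d) ∧
  (∀ c ∈ μ, ∀ d ∈ μ, c.2 = d.2 → c.1 < d.1 → T c < T d)

/-- The `i`-th K-Bender-Knuth involution: every entry `i` with no adjacent cell
containing `i+1` becomes `i+1`, and every entry `i+1` with no adjacent cell
containing `i` becomes `i`. -/
noncomputable def kbkMap (μ : Finset (ℕ × ℕ)) (i : ℕ) (T : ℕ × ℕ → ℕ) : ℕ × ℕ → ℕ :=
  fun c =>
    if c ∈ μ ∧ T c = i ∧ ¬ ∃ d ∈ μ, incAdj c d ∧ T d = i + 1 then i + 1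
    else if c ∈ μ ∧ T c = i + 1 ∧ ¬ ∃ d ∈ μ, incAdj c d ∧ T d = i then i
    else T c

/-- K-promotion `∂ = kbk_{q-1} ∘ ⋯ ∘ kbk_1` (with `kbk_1` applied first). -/
noncomputable def kPromo (μ : Finset (ℕ × ℕ)) (q : ℕ) (T : ℕ × ℕ → ℕ) : ℕ × ℕ → ℕ :=
  (List.range (q - 1)).foldl (fun S k => kbkMap μ (k + 1) S) T

/-- The cells of the rectangular shape `a × b` (rows `0,…,a-1`, columns `0,…,b-1`). -/
def rectCells (a b : ℕ) : Finset (ℕ × ℕ) := Finset.range a ×ˢ Finset.range b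

/-- Increasing tableaux of rectangular shape `a × b` with entries at most `q`,
represented canonically as functions `ℕ × ℕ → ℕ` vanishing off the rectangle. -/
def IncTabSet (a b q : ℕ) : Set (ℕ × ℕ → ℕ) :=
  {T | IsIncTab (rectCells a b) q T ∧ ∀ p : ℕ × ℕ, p ∉ rectCells a b → T p = 0}

/-- The map `Ψ₃` : the entry of `Ψ₃(I)` in (0-indexed) row `r` and column `s`
is `#{k : (a-1-r, b-1-s, k) ∈ I} + r + s + 1` (in 1-indexed terms, the entry in
row `i`, column `j` is `#{k : (a-i, b-j, k) ∈ I} + i + j - 1`); cells outside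
the rectangle are assigned the value `0`. -/
noncomputable def Psi3 (a b c : ℕ) (I : Set (Fin a × Fin b × Fin c)) :
    ℕ × ℕ → ℕ :=
  fun p =>
    if p.1 < a ∧ p.2 < b then
      (Finset.univ.filter (fun x : Fin a × Fin b × Fin c =>
        x ∈ I ∧ (x.1 : ℕ) = a - 1 - p.1 ∧ (x.2.1 : ℕ) = b - 1 - p.2)).card
        + p.1 + p.2 + 1
    else 0

/-- Membership in a lower set of `Fin c` is decided by its cardinality. -/
theorem aux_mem_iff {c : ℕ} (S : Set (Fin c)) (hS : IsLowerSet S) (k : Fin c) :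
    k ∈ S ↔ (k : ℕ) < (Finset.univ.filter (fun j : Fin c => j ∈ S)).card := by
  constructor
  · intro hk
    have h : Finset.Iic k ⊆ Finset.univ.filter (fun j : Fin c => j ∈ S) := by
      intro j hj
      simp only [Finset.mem_Iic] at hj
      simp only [Finset.mem_filter, Finset.mem_univ, true_and]
      exact hS hj hk
    have := Finset.card_le_card h
    rw [Fin.card_Iic] at this
    omega
  · intro hk
    by_contra hn
    have h : Finset.univ.filter (fun j : Fin c => j ∈ S) ⊆ Finset.Iio k := by
      intro j hj
      simp only [Finset.mem_filter, Finset.mem_univ, true_and] at hj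
      simp only [Finset.mem_Iio]
      by_contra hlt
      exact hn (hS (not_lt.mp hlt) hj)
    have := Finset.card_le_card h
    rw [Fin.card_Iio] at this
    omega

/-- The height of the fibre of `I` over `(x, y)`. -/
noncomputable def auxH {a b c : ℕ} (I : Set (Fin a × Fin b × Fin c)) (x : Fin a) (y : Fin b) : ℕ :=
  (Finset.univ.filter (fun j : Fin c => j ∈ {k : Fin c | (x, y, k) ∈ I})).card

theorem auxH_le {a b c : ℕ} (I : Set (Fin a × Fin b × Fin c)) (x : Fin a) (y : Fin b) :
    auxH I x y ≤ c := by
  unfold auxH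
  exact (Finset.card_le_univ _).trans (by simp)

theorem auxH_mem {a b c : ℕ} (I : Set (Fin a × Fin b × Fin c)) (hI : IsLowerSet I)
    (x : Fin a) (y : Fin b) (k : Fin c) : (x, y, k) ∈ I ↔ (k : ℕ) < auxH I x y := by
  have hS : IsLowerSet {k : Fin c | (x, y, k) ∈ I} := by
    intro k l hl hk
    exact hI (show (x, y, l) ≤ (x, y, k) from ⟨le_refl _, le_refl _, hl⟩) hk
  exact aux_mem_iff _ hS k

theorem auxH_anti {a b c : ℕ} (I : Set (Fin a × Fin b × Fin c)) (hI : IsLowerSet I)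
    {x x' : Fin a} {y y' : Fin b} (hx : x ≤ x') (hy : y ≤ y') : auxH I x' y' ≤ auxH I x y := by
  unfold auxH
  apply Finset.card_le_card
  intro k hk
  simp only [Finset.mem_filter, Finset.mem_univ, true_and, Set.mem_ofPred_eq] at hk ⊢
  exact hI (show (x, y, k) ≤ (x', y', k) from ⟨hx, hy, le_refl _⟩) hk

theorem Psi3_eq {a b c : ℕ} (I : Set (Fin a × Fin b × Fin c)) (r s : ℕ) (hr : r < a) (hs : s < b) :
    Psi3 a b c I (r, s) =
      auxH I ⟨a - 1 - r, by omega⟩ ⟨b - 1 - s, by omega⟩ + r + s + 1 := by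
  have hr' : a - 1 - r < a := by omega
  have hs' : b - 1 - s < b := by omega
  unfold Psi3 auxH
  rw [if_pos ⟨hr, hs⟩]
  congr 3
  symm
  refine Finset.card_bij (fun k _ => (⟨a - 1 - r, by omega⟩, ⟨b - 1 - s, by omega⟩, k)) ?_ ?_ ?_
  · intro k hk
    simpa using hk
  · intro k _ l _ h
    simpa using h
  · rintro ⟨x, y, k⟩ h
    simp only [Finset.mem_filter, Finset.mem_univ, true_and] at h
    obtain ⟨h1, h2, h3⟩ := h
    obtain rfl : x = ⟨a - 1 - r, hr'⟩ := Fin.ext h2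
    obtain rfl : y = ⟨b - 1 - s, hs'⟩ := Fin.ext h3
    exact ⟨k, by simpa using h1, rfl⟩

theorem aux_tab_mono {a b q : ℕ} {T : ℕ × ℕ → ℕ} (hT : IsIncTab (rectCells a b) q T)
    (d e r s : ℕ) (hr : r + d < a) (hs : s + e < b) :
    T (r, s) + d + e ≤ T (r + d, s + e) := by
  obtain ⟨-, h2, h3⟩ := hT
  have hd : T (r, s) + d ≤ T (r + d, s) := by
    induction d with
    | zero => simp
    | succ d ih =>
      have := ih (by omega)
      have := h3 (r + d, s) (by simp [rectCells]; omega) (r + (d + 1), s)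
        (by simp [rectCells]; omega) rfl (by simp)
      omega
  have he : T (r + d, s) + e ≤ T (r + d, s + e) := by
    clear hd
    induction e with
    | zero => simp
    | succ e ih =>
      have := ih (by omega)
      have := h2 (r + d, s + e) (by simp [rectCells]; omega) (r + d, s + (e + 1))
        (by simp [rectCells]; omega) rfl (by simp)
      omega
  omega

theorem aux_tab_mono' {a b q : ℕ} {T : ℕ × ℕ → ℕ} (hT : IsIncTab (rectCells a b) q T)
    {r s r' s' : ℕ} (h1 : r ≤ r') (h2 : s ≤ s') (hr : r' < a) (hs : s' < b) :
    T (r, s) + (r' - r) + (s' - s) ≤ T (r', s') := by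
  have := aux_tab_mono hT (r' - r) (s' - s) r s (by omega) (by omega)
  rwa [Nat.add_sub_cancel' h1, Nat.add_sub_cancel' h2] at this

/-- Theorem 4.1: `Ψ₃` is a bijection from the order ideals of
`Fin a × Fin b × Fin c` onto the increasing tableaux of shape `a × b` with
entries at most `a + b + c - 1`. -/
theorem Psi3_bijection (a b c : ℕ) (ha : 0 < a) (hb : 0 < b) (hc : 0 < c) :
    Set.BijOn (Psi3 a b c) {I : Set (Fin a × Fin b × Fin c) | IsLowerSet I}
      (IncTabSet a b (a + b + c - 1)) := by
  refine ⟨?_, ?_, ?_⟩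
  · intro I hI
    refine ⟨⟨?_, ?_, ?_⟩, ?_⟩
    · rintro ⟨r, s⟩ h
      simp only [rectCells, Finset.mem_product, Finset.mem_range] at h
      rw [Psi3_eq I r s h.1 h.2]
      have := auxH_le I ⟨a - 1 - r, by omega⟩ ⟨b - 1 - s, by omega⟩
      omega
    · rintro ⟨r, s⟩ h ⟨r', s'⟩ h' h1 h2
      simp only [rectCells, Finset.mem_product, Finset.mem_range] at h h' h1 h2
      subst h1
      rw [Psi3_eq I r s h.1 h.2, Psi3_eq I r s' h'.1 h'.2]
      have := auxH_anti I hI (le_refl (⟨a - 1 - r, by omega⟩ : Fin a))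
        (show (⟨b - 1 - s', by omega⟩ : Fin b) ≤ ⟨b - 1 - s, by omega⟩ by
          rw [Fin.mk_le_mk]; omega)
      omega
    · rintro ⟨r, s⟩ h ⟨r', s'⟩ h' h1 h2
      simp only [rectCells, Finset.mem_product, Finset.mem_range] at h h' h1 h2
      subst h1
      rw [Psi3_eq I r s h.1 h.2, Psi3_eq I r' s h'.1 h'.2]
      have := auxH_anti I hI
        (show (⟨a - 1 - r', by omega⟩ : Fin a) ≤ ⟨a - 1 - r, by omega⟩ by
          rw [Fin.mk_le_mk]; omega) (le_refl (⟨b - 1 - s, by omega⟩ : Fin b))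
      omega
    · rintro ⟨r, s⟩ h
      simp only [rectCells, Finset.mem_product, Finset.mem_range] at h
      unfold Psi3
      rw [if_neg h]
  · intro I hI J hJ hIJ
    ext ⟨x, y, k⟩
    rw [auxH_mem I hI, auxH_mem J hJ]
    have h := congrFun hIJ (a - 1 - x, b - 1 - y)
    rw [Psi3_eq I _ _ (by omega) (by omega), Psi3_eq J _ _ (by omega) (by omega)] at h
    have hx : (⟨a - 1 - (a - 1 - x), by omega⟩ : Fin a) = x := Fin.ext (by simp; omega)
    have hy : (⟨b - 1 - (b - 1 - y), by omega⟩ : Fin b) = y := Fin.ext (by simp; omega)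
    rw [hx, hy] at h
    have : auxH I x y = auxH J x y := by omega
    rw [this]
  · rintro T ⟨hT, hT0⟩
    let I : Set (Fin a × Fin b × Fin c) := {x | (x.2.2 : ℕ) + (a - 1 - x.1) + (b - 1 - x.2.1) + 1 <
      T (a - 1 - x.1, b - 1 - x.2.1)}
    have hI : IsLowerSet I := by
      rintro ⟨x, y, k⟩ ⟨x', y', k'⟩ ⟨h1, h2, h3⟩ h
      simp only [Fin.le_def] at h1 h2 h3
      simp only [I, Set.mem_ofPred_eq] at h ⊢
      have := aux_tab_mono' hT (r := a - 1 - x) (s := b - 1 - y) (r' := a - 1 - x')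
        (s' := b - 1 - y') (by omega) (by omega) (by omega) (by omega)
      omega
    refine ⟨I, hI, ?_⟩
    ext ⟨r, s⟩
    by_cases h : r < a ∧ s < b
    · rw [Psi3_eq I r s h.1 h.2]
      have hm := auxH_mem I hI ⟨a - 1 - r, by omega⟩ ⟨b - 1 - s, by omega⟩
      have hle := auxH_le I ⟨a - 1 - r, by omega⟩ ⟨b - 1 - s, by omega⟩
      generalize auxH I ⟨a - 1 - r, by omega⟩ ⟨b - 1 - s, by omega⟩ = n at hm hle
      simp only [I, Set.mem_ofPred_eq] at hm
      rw [show a - 1 - (a - 1 - r) = r by omega, show b - 1 - (b - 1 - s) = s by omega] at hm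
      have hlo := aux_tab_mono' hT (Nat.zero_le r) (Nat.zero_le s) h.1 h.2
      have h0 := (hT.1 (0, 0) (by simp [rectCells]; omega)).1
      have hhi := aux_tab_mono' hT (r := r) (s := s) (r' := a - 1) (s' := b - 1)
        (by omega) (by omega) (by omega) (by omega)
      have h9 := (hT.1 (a - 1, b - 1) (by simp [rectCells]; omega)).2
      rcases lt_trichotomy (n + r + s + 1) (T (r, s)) with hlt | heq | hgt
      · have := (hm ⟨n, by omega⟩).1 (by simp only; omega)
        simp at this
      · exact heq
      · have := (hm ⟨n - 1, by omega⟩).2 (by simp only; omega)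
        simp only at this
        omega
    · rw [hT0 (r, s) (by simpa [rectCells] using h)]
      unfold Psi3
      rw [if_neg h]
end

section
/- Let a, b, c be positive integers and q = a+b+c−1. For every order ideal I ∈ J(𝐚×𝐛×𝐜), Ψ₃(Pro_{id,(1,1,−1)}(I)) = ∂(Ψ₃(I)); that is, the bijection Ψ₃ intertwines the hyperplane-toggle promotion Pro_{id,(1,1,−1)} on order ideals with K-promotion ∂ on increasing tableaux. -/
open scoped Classical

/-- `Pro_{id,(1,1,−1)}` on `J(Fin a × Fin b × Fin c)`: the hyperplane toggles
`T^h` (toggling all `x` with `x₁ + x₂ - x₃ = h`) applied successively for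
`h = a+b-2, a+b-3, …, -(c-1)` in decreasing order (`h = a+b-2` first). -/
noncomputable def proHyper (a b c : ℕ) (I : Set (Fin a × Fin b × Fin c)) :
    Set (Fin a × Fin b × Fin c) :=
  ((List.range (a + b + c - 2)).map fun k => ((a : ℤ) + (b : ℤ) - 2 - (k : ℤ))).foldl
    (fun J h =>
      hyperTog {x : Fin a × Fin b × Fin c |
        ((x.1 : ℕ) : ℤ) + ((x.2.1 : ℕ) : ℤ) - ((x.2.2 : ℕ) : ℤ) = h} J) I

def Good3 (a b c : ℕ) (f : ℕ → ℕ → ℕ) : Prop :=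
  (∀ x y, x < a → y < b → f x y ≤ c) ∧
  (∀ x y, x + 1 < a → y < b → f (x+1) y ≤ f x y) ∧
  (∀ x y, x < a → y + 1 < b → f x (y+1) ≤ f x y)

def Jset (a b c : ℕ) (f : ℕ → ℕ → ℕ) : Set (Fin a × Fin b × Fin c) :=
  {x | (x.2.2 : ℕ) < f x.1 x.2.1}

theorem mem_Jset {a b c : ℕ} {f : ℕ → ℕ → ℕ} (x : Fin a) (y : Fin b) (k : Fin c) :
    (x, y, k) ∈ Jset a b c f ↔ (k : ℕ) < f x y := Iff.rfl

def addC (a b c κ : ℕ) (f : ℕ → ℕ → ℕ) (x y : ℕ) : Prop :=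
  f x y + (a - 1 - x) + (b - 1 - y) = κ ∧ f x y < c ∧
    (0 < x → f x y < f (x-1) y) ∧ (0 < y → f x y < f x (y-1))

def remC (a b κ : ℕ) (f : ℕ → ℕ → ℕ) (x y : ℕ) : Prop :=
  f x y + (a - 1 - x) + (b - 1 - y) = κ + 1 ∧ 0 < f x y ∧
    (x + 1 < a → f (x+1) y < f x y) ∧ (y + 1 < b → f x (y+1) < f x y)

noncomputable def togF (a b c κ : ℕ) (f : ℕ → ℕ → ℕ) : ℕ → ℕ → ℕ := fun x y =>
  if addC a b c κ f x y then f x y + 1 else if remC a b κ f x y then f x y - 1 else f x y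

theorem Good3.anti {a b c : ℕ} {f : ℕ → ℕ → ℕ} (h : Good3 a b c f) {x x' y y' : ℕ}
    (hx : x ≤ x') (hy : y ≤ y') (hxa : x' < a) (hyb : y' < b) : f x' y' ≤ f x y := by
  obtain ⟨_, h1, h2⟩ := h
  have e1 : f x' y' ≤ f x y' := by
    clear h2
    induction x', hx using Nat.le_induction with
    | base => exact le_rfl
    | succ n hn ih => exact (h1 n y' hxa hyb).trans (ih (by omega))
  have e2 : f x y' ≤ f x y := by
    clear e1 h1
    induction y', hy using Nat.le_induction with
    | base => exact le_rfl
    | succ n hn ih => exact (h2 x n (by omega) hyb).trans (ih (by omega))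
  exact e1.trans e2

theorem Good3.tog {a b c κ : ℕ} {f : ℕ → ℕ → ℕ} (h : Good3 a b c f) :
    Good3 a b c (togF a b c κ f) := by
  obtain ⟨h0, h1, h2⟩ := h
  refine ⟨fun x y hx hy => ?_, fun x y hx hy => ?_, fun x y hx hy => ?_⟩
  · have := h0 x y hx hy
    unfold togF addC
    split_ifs <;> omega
  · have := h1 x y hx hy
    unfold togF addC remC
    simp only [Nat.add_sub_cancel]
    split_ifs <;> omega
  · have := h2 x y hx hy
    unfold togF addC remC
    simp only [Nat.add_sub_cancel]
    split_ifs <;> omega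

theorem exists_good {a b c : ℕ} (J : Set (Fin a × Fin b × Fin c)) (hJ : IsLowerSet J) :
    ∃ f, Good3 a b c f ∧ J = Jset a b c f := by
  let F : ℕ → ℕ → Finset (Fin c) := fun x y =>
    Finset.univ.filter fun k => ∃ (hx : x < a) (hy : y < b), ((⟨x, hx⟩, ⟨y, hy⟩, k) : Fin a × Fin b × Fin c) ∈ J
  refine ⟨fun x y => (F x y).card, ⟨fun x y _ _ => ?_, fun x y hx hy => ?_, fun x y hx hy => ?_⟩, ?_⟩
  · simpa using Finset.card_le_univ (F x y)
  · apply Finset.card_le_card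
    intro k hk
    simp only [F, Finset.mem_filter, Finset.mem_univ, true_and] at hk ⊢
    obtain ⟨h1, h2, h3⟩ := hk
    refine ⟨by omega, h2, hJ ?_ h3⟩
    simp [Prod.le_def, Fin.le_def]
  · apply Finset.card_le_card
    intro k hk
    simp only [F, Finset.mem_filter, Finset.mem_univ, true_and] at hk ⊢
    obtain ⟨h1, h2, h3⟩ := hk
    refine ⟨h1, by omega, hJ ?_ h3⟩
    simp [Prod.le_def, Fin.le_def]
  · ext ⟨x, y, k⟩
    simp only [Jset, Set.mem_ofPred_eq]
    constructor
    · intro h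
      have : Finset.Iic k ⊆ F x y := by
        intro j hj
        simp only [F, Finset.mem_filter, Finset.mem_univ, true_and]
        refine ⟨x.2, y.2, hJ ?_ h⟩
        simpa [Prod.le_def] using hj
      have := Finset.card_le_card this
      simp at this
      omega
    · intro h
      by_contra hn
      have : F x y ⊆ Finset.Iio k := by
        intro j hj
        simp only [F, Finset.mem_filter, Finset.mem_univ, true_and] at hj
        obtain ⟨_, _, hj⟩ := hj
        rw [Finset.mem_Iio]
        by_contra hk
        refine hn (hJ ?_ hj)
        simpa [Prod.le_def] using hk
      have := Finset.card_le_card this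
      simp at this
      omega

theorem Psi3_Jset {a b c : ℕ} {f : ℕ → ℕ → ℕ} (h : Good3 a b c f) (p : ℕ × ℕ) :
    Psi3 a b c (Jset a b c f) p =
      if p.1 < a ∧ p.2 < b then f (a - 1 - p.1) (b - 1 - p.2) + p.1 + p.2 + 1 else 0 := by
  unfold Psi3
  split_ifs with hp
  · congr 3
    obtain ⟨h1, h2⟩ := hp
    have hc := h.1 (a - 1 - p.1) (b - 1 - p.2) (by omega) (by omega)
    rw [← Finset.card_range (f (a - 1 - p.1) (b - 1 - p.2))]
    refine Finset.card_bij (fun x _ => (x.2.2 : ℕ)) ?_ ?_ ?_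
    · rintro ⟨x, y, k⟩ hx
      simp only [Finset.mem_filter, Finset.mem_univ, true_and, mem_Jset, Finset.mem_range] at hx ⊢
      rw [← hx.2.1, ← hx.2.2]; exact hx.1
    · rintro ⟨x, y, k⟩ hx ⟨x', y', k'⟩ hx' hk
      simp only [Finset.mem_filter, Finset.mem_univ, true_and] at hx hx' hk
      simp only [Prod.mk.injEq, Fin.ext_iff]
      omega
    · intro k hk
      rw [Finset.mem_range] at hk
      refine ⟨(⟨a - 1 - p.1, by omega⟩, ⟨b - 1 - p.2, by omega⟩, ⟨k, by omega⟩), ?_, rfl⟩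
      simp only [Finset.mem_filter, Finset.mem_univ, true_and, mem_Jset, and_self, and_true]
      exact hk
  · rfl

theorem Good3.lower {a b c : ℕ} {f : ℕ → ℕ → ℕ} (h : Good3 a b c f) :
    IsLowerSet (Jset a b c f) := by
  rintro ⟨x, y, k⟩ ⟨x', y', k'⟩ hle hm
  simp only [mem_Jset, Prod.mk_le_mk, Fin.le_def] at hle hm ⊢
  have := h.anti hle.1 hle.2.1 x.2 y.2
  omega

theorem add_iff {a b c : ℕ} {f : ℕ → ℕ → ℕ} (h : Good3 a b c f) (x : Fin a) (y : Fin b) (k : Fin c)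
    (hk : f x y ≤ k) :
    IsLowerSet (Jset a b c f ∪ {(x, y, k)}) ↔
      (k : ℕ) = f x y ∧ (0 < (x : ℕ) → f x y < f (x-1) y) ∧ (0 < (y : ℕ) → f x y < f x (y-1)) := by
  constructor
  · intro hl
    have key : ∀ (x' : Fin a) (y' : Fin b) (k' : Fin c), (x', y', k') ≤ (x, y, k) →
        (x', y', k') ≠ (x, y, k) → (k' : ℕ) < f x' y' := by
      intro x' y' k' h1 h2
      have := hl h1 (Or.inr rfl)
      rcases this with h3 | h3
      · exact h3
      · exact absurd h3 h2
    have e : (k : ℕ) = f x y := by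
      by_contra hne
      have := key x y ⟨f x y, by omega⟩ (by simp [Prod.le_def, Fin.le_def, hk])
        (by simp [Fin.ext_iff]; omega)
      simp at this
    refine ⟨e, fun h0 => ?_, fun h0 => ?_⟩
    · have := key ⟨x - 1, by omega⟩ y k (by simp [Prod.le_def, Fin.le_def]) (by simp [Fin.ext_iff]; omega)
      simp at this; omega
    · have := key x ⟨y - 1, by omega⟩ k (by simp [Prod.le_def, Fin.le_def]) (by simp [Fin.ext_iff]; omega)
      simp at this; omega
  · rintro ⟨e, h1, h2⟩ u ⟨x', y', k'⟩ hle hm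
    rcases hm with hm | hm
    · exact Or.inl (h.lower hle hm)
    · rw [Set.mem_singleton_iff] at hm
      subst hm
      by_cases heq : (x', y', k') = (x, y, k)
      · exact Or.inr heq
      · left
        simp only [mem_Jset, Prod.mk_le_mk, Fin.le_def, Fin.ext_iff, Prod.mk.injEq] at hle heq ⊢
        by_cases hx : (x' : ℕ) = x
        · by_cases hy : (y' : ℕ) = y
          · rw [hx, hy]; omega
          · have := h2 (by omega)
            have := h.anti (x := x') (x' := x) (y := y') (y' := y - 1) (by omega) (by omega) x.2 (by omega)
            omega
        · have := h1 (by omega)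
          have := h.anti (x := x') (x' := x - 1) (y := y') (y' := y) (by omega) (by omega) (by omega) y.2
          omega

theorem rem_iff {a b c : ℕ} {f : ℕ → ℕ → ℕ} (h : Good3 a b c f) (x : Fin a) (y : Fin b) (k : Fin c)
    (hk : (k : ℕ) < f x y) :
    IsLowerSet (Jset a b c f \ {(x, y, k)}) ↔
      (k : ℕ) + 1 = f x y ∧ ((x : ℕ) + 1 < a → f (x+1) y < f x y) ∧
        ((y : ℕ) + 1 < b → f x (y+1) < f x y) := by
  have hc := h.1 x y x.2 y.2
  constructor
  · intro hl
    have key : ∀ (x' : Fin a) (y' : Fin b) (k' : Fin c), (x, y, k) ≤ (x', y', k') →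
        (x', y', k') ≠ (x, y, k) → f x' y' ≤ (k' : ℕ) := by
      intro x' y' k' h1 h2
      by_contra h3
      have := hl h1 ⟨by simpa [mem_Jset] using h3, h2⟩
      exact this.2 rfl
    have e : (k : ℕ) + 1 = f x y := by
      by_contra hne
      have := key x y ⟨k + 1, by omega⟩ (by simp [Prod.le_def, Fin.le_def])
        (by simp [Fin.ext_iff])
      simp at this; omega
    refine ⟨e, fun h0 => ?_, fun h0 => ?_⟩
    · have := key ⟨x + 1, by omega⟩ y k (by simp [Prod.le_def, Fin.le_def]) (by simp [Fin.ext_iff])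
      simp at this; omega
    · have := key x ⟨y + 1, by omega⟩ k (by simp [Prod.le_def, Fin.le_def]) (by simp [Fin.ext_iff])
      simp at this; omega
  · rintro ⟨e, h1, h2⟩ ⟨x', y', k'⟩ u hle hm
    refine ⟨h.lower hle hm.1, ?_⟩
    intro hu
    rw [Set.mem_singleton_iff] at hu
    subst hu
    obtain ⟨hm, hne⟩ := hm
    simp only [mem_Jset, Prod.mk_le_mk, Fin.le_def, Fin.ext_iff, Prod.mk.injEq, Set.mem_singleton_iff] at hle hm hne
    by_cases hx : (x' : ℕ) = x
    · by_cases hy : (y' : ℕ) = y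
      · rw [hx, hy] at hm; omega
      · have := h2 (by omega)
        have := h.anti (x := x) (x' := x') (y := y + 1) (y' := y') (by omega) (by omega) x'.2 y'.2
        omega
    · have := h1 (by omega)
      have := h.anti (x := x + 1) (x' := x') (y := y) (y' := y') (by omega) (by omega) x'.2 y'.2
      omega

theorem hyperTog_Jset {a b c κ : ℕ} {f : ℕ → ℕ → ℕ} (h : Good3 a b c f) :
    hyperTog {x : Fin a × Fin b × Fin c |
        ((x.1 : ℕ) : ℤ) + ((x.2.1 : ℕ) : ℤ) - ((x.2.2 : ℕ) : ℤ) = (a : ℤ) + (b : ℤ) - 2 - (κ : ℤ)}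
      (Jset a b c f) = Jset a b c (togF a b c κ f) := by
  ext ⟨x, y, k⟩
  have hm : ∀ g, (x, y, k) ∈ Jset a b c g ↔ (k : ℕ) < g x y := fun g => Iff.rfl
  have hx := x.2
  have hy := y.2
  have hkc := k.2
  simp only [hyperTog, Set.mem_ofPred_eq, hm]
  unfold togF
  by_cases hk : (k : ℕ) < f x y
  · rw [rem_iff h x y k hk]
    unfold addC remC
    split_ifs <;> omega
  · rw [add_iff h x y k (by omega)]
    unfold addC remC
    split_ifs <;> omega

set_option maxHeartbeats 4000000 in
theorem kbk_step {a b c κ : ℕ} {f : ℕ → ℕ → ℕ} (h : Good3 a b c f) (hκ : κ < a + b + c - 2) :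
    Psi3 a b c (Jset a b c (togF a b c κ f)) =
      kbkMap (rectCells a b) (κ + 1) (Psi3 a b c (Jset a b c f)) := by
  funext ⟨r, s⟩
  have hmem : ∀ u v, (u, v) ∈ rectCells a b ↔ u < a ∧ v < b := by
    intro u v; simp [rectCells]
  by_cases hp : r < a ∧ s < b
  swap
  · rw [Psi3_Jset h.tog]
    unfold kbkMap
    simp [hmem, hp, Psi3_Jset h]
  obtain ⟨hr, hs⟩ := hp
  obtain ⟨x, rfl⟩ : ∃ x, a = x + 1 + r := ⟨a - 1 - r, by omega⟩
  obtain ⟨y, rfl⟩ : ∃ y, b = y + 1 + s := ⟨b - 1 - s, by omega⟩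
  have hT : ∀ u v, u < x + 1 + r → v < y + 1 + s →
      Psi3 (x+1+r) (y+1+s) c (Jset (x+1+r) (y+1+s) c f) (u, v)
        = f (x + r - u) (y + s - v) + u + v + 1 := by
    intro u v hu hv
    rw [Psi3_Jset h, if_pos ⟨hu, hv⟩]
    congr 4 <;> simp <;> omega
  have h0 := h.1 x y (by omega) (by omega)
  have hadj : ∀ m, (∃ d ∈ rectCells (x+1+r) (y+1+s), incAdj (r, s) d ∧
      Psi3 (x+1+r) (y+1+s) c (Jset (x+1+r) (y+1+s) c f) d = m) ↔
      (0 < x ∧ f (x-1) y + r + s + 2 = m) ∨ (0 < y ∧ f x (y-1) + r + s + 2 = m) ∨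
      (0 < r ∧ f (x+1) y + r + s = m) ∨ (0 < s ∧ f x (y+1) + r + s = m) := by
    intro m
    constructor
    · rintro ⟨⟨u, v⟩, hd, hadj, hv⟩
      rw [hmem] at hd
      rw [hT u v hd.1 hd.2] at hv
      simp only [incAdj] at hadj
      rcases hadj with ⟨rfl, h1 | h1⟩ | ⟨rfl, h1 | h1⟩
      · right; left
        rw [show x + r - r = x by omega, show y + s - v = y - 1 by omega] at hv
        omega
      · right; right; right
        rw [show x + r - r = x by omega, show y + s - v = y + 1 by omega] at hv
        omega
      · left
        rw [show x + r - u = x - 1 by omega, show y + s - s = y by omega] at hv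
        omega
      · right; right; left
        rw [show x + r - u = x + 1 by omega, show y + s - s = y by omega] at hv
        omega
    · rintro (⟨h1, h2⟩ | ⟨h1, h2⟩ | ⟨h1, h2⟩ | ⟨h1, h2⟩)
      · refine ⟨(r+1, s), (hmem _ _).2 (by omega), by simp [incAdj], ?_⟩
        rw [hT _ _ (by omega) (by omega), show x + r - (r+1) = x - 1 by omega,
          show y + s - s = y by omega]
        omega
      · refine ⟨(r, s+1), (hmem _ _).2 (by omega), by simp [incAdj], ?_⟩
        rw [hT _ _ (by omega) (by omega), show x + r - r = x by omega,
          show y + s - (s+1) = y - 1 by omega]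
        omega
      · refine ⟨(r-1, s), (hmem _ _).2 (by omega), by simp [incAdj]; omega, ?_⟩
        rw [hT _ _ (by omega) (by omega), show x + r - (r-1) = x + 1 by omega,
          show y + s - s = y by omega]
        omega
      · refine ⟨(r, s-1), (hmem _ _).2 (by omega), by simp [incAdj]; omega, ?_⟩
        rw [hT _ _ (by omega) (by omega), show x + r - r = x by omega,
          show y + s - (s-1) = y + 1 by omega]
        omega
  have l1 : 0 < x → f x y ≤ f (x-1) y ∧ f (x-1) y ≤ c := fun _ =>
    ⟨h.anti (by omega) le_rfl (by omega) (by omega), h.1 _ _ (by omega) (by omega)⟩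
  have l2 : 0 < y → f x y ≤ f x (y-1) ∧ f x (y-1) ≤ c := fun _ =>
    ⟨h.anti le_rfl (by omega) (by omega) (by omega), h.1 _ _ (by omega) (by omega)⟩
  have l3 : 0 < r → f (x+1) y ≤ f x y := fun _ => h.2.1 _ _ (by omega) (by omega)
  have l4 : 0 < s → f x (y+1) ≤ f x y := fun _ => h.2.2 _ _ (by omega) (by omega)
  rw [Psi3_Jset h.tog]
  unfold kbkMap
  simp only [hadj]
  simp only [hmem]
  rw [hT r s hr hs, if_pos ⟨hr, hs⟩]
  simp only [show x + r - r = x by omega, show y + s - s = y by omega,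
    show x + 1 + r - 1 - r = x by omega, show y + 1 + s - 1 - s = y by omega]
  unfold togF addC remC
  simp only [show x + 1 + r - 1 - x = r by omega, show y + 1 + s - 1 - y = s by omega]
  clear hadj hT hmem
  split_ifs <;> omega

theorem fold_step {a b c : ℕ} (n : ℕ) (hn : n ≤ a + b + c - 2) {f : ℕ → ℕ → ℕ}
    (h : Good3 a b c f) : ∃ g, Good3 a b c g ∧
    ((List.range n).map fun k : ℕ => ((a : ℤ) + (b : ℤ) - 2 - (k : ℤ))).foldl
    (fun J h =>
      hyperTog {x : Fin a × Fin b × Fin c |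
        ((x.1 : ℕ) : ℤ) + ((x.2.1 : ℕ) : ℤ) - ((x.2.2 : ℕ) : ℤ) = h} J) (Jset a b c f)
      = Jset a b c g ∧
    Psi3 a b c (Jset a b c g) =
      (List.range n).foldl (fun S k => kbkMap (rectCells a b) (k + 1) S)
        (Psi3 a b c (Jset a b c f)) := by
  induction n with
  | zero => exact ⟨f, h, rfl, rfl⟩
  | succ n ih =>
    obtain ⟨g, hg, e1, e2⟩ := ih (by omega)
    refine ⟨togF a b c n g, hg.tog, ?_, ?_⟩
    · rw [List.range_succ, List.map_append, List.foldl_append, e1]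
      exact hyperTog_Jset hg
    · rw [List.range_succ, List.foldl_append, ← e2]
      exact kbk_step hg (by omega)

/-- Lemma 4.2: `Ψ₃` intertwines `Pro_{id,(1,1,−1)}` on order ideals of
`Fin a × Fin b × Fin c` with K-promotion `∂` on `Inc^{a+b+c-1}(a×b)`. -/
theorem Psi3_intertwines (a b c : ℕ) (ha : 0 < a) (hb : 0 < b) (hc : 0 < c)
    (I : Set (Fin a × Fin b × Fin c)) (hI : IsLowerSet I) :
    Psi3 a b c (proHyper a b c I) =
      kPromo (rectCells a b) (a + b + c - 1) (Psi3 a b c I) := by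
  obtain ⟨f, hf, rfl⟩ := exists_good I hI
  obtain ⟨g, hg, e1, e2⟩ := fold_step (a + b + c - 2) le_rfl hf
  unfold proHyper kPromo
  have e3 : (do
      let k ← List.range (a + b + c - 2)
      pure (k : ℤ)) = (List.range (a + b + c - 2)).map (fun k : ℕ => (k : ℤ)) := by
    rw [List.map_eq_flatMap]; rfl
  rw [e3, List.map_map]
  have e1' := e1
  simp only [Function.comp_def] at e1' ⊢
  rw [e1', e2, show a + b + c - 1 - 1 = a + b + c - 2 by omega]
end

section
/- Let a, b, c be positive integers and q = a+b+c−1. Then J(𝐚×𝐛×𝐜) under rowmotion Row is in equivariant bijection with Inc^q(a×b) under K-promotion ∂; that is, there exists a bijection φ : J(𝐚×𝐛×𝐜) → Inc^q(a×b) with φ ∘ Row = ∂ ∘ φ. -/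
open scoped Classical

/-- Rowmotion on order ideals (lower sets) of a poset `P`: `I` is sent to the
order ideal generated by the minimal elements of the complement of `I`. -/
def rowmo {P : Type*} [PartialOrder P] (I : Set P) : Set P :=
  {x | ∃ m, Minimal (fun y => y ∉ I) m ∧ x ≤ m}


namespace RowK

/-- Membership in `I` in natural-number coordinates, first two coordinates reversed. -/
def FF {a b c : ℕ} (I : Set (Fin a × Fin b × Fin c)) (i j z : ℕ) : Prop :=
  ∃ (hi : i < a) (hj : j < b) (hz : z < c),
    ((⟨a - 1 - i, by omega⟩, ⟨b - 1 - j, by omega⟩, ⟨z, hz⟩) : Fin a × Fin b × Fin c) ∈ I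

structure Low (a b c : ℕ) (D : ℕ → ℕ → ℕ → Prop) : Prop where
  sup : ∀ i j z, D i j z → i < a ∧ j < b ∧ z < c
  hz : ∀ i j z, D i j (z + 1) → D i j z
  hi : ∀ i j z, D i j z → i + 1 < a → D (i + 1) j z
  hj : ∀ i j z, D i j z → j + 1 < b → D i (j + 1) z

/-- The local rule of rowmotion from `D` to `E`. -/
structure Rule (a b c : ℕ) (D E : ℕ → ℕ → ℕ → Prop) : Prop where
  bz : ∀ i j z, E i j (z + 1) → D i j z
  bi : ∀ i j z, E i j z → i + 1 < a → D (i + 1) j z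
  bj : ∀ i j z, E i j z → j + 1 < b → D i (j + 1) z
  rule : ∀ i j z, i < a → j < b → z < c → (E i j z ↔
    (∃ i', i = i' + 1 ∧ E i' j z) ∨ (∃ j', j = j' + 1 ∧ E i j' z) ∨ E i j (z + 1) ∨
    (¬ D i j z ∧ (i + 1 < a → D (i + 1) j z) ∧ (j + 1 < b → D i (j + 1) z) ∧
      (∀ z', z = z' + 1 → D i j z')))

noncomputable def tab (a b c : ℕ) (D : ℕ → ℕ → ℕ → Prop) : ℕ × ℕ → ℕ := fun p =>
  if p ∈ rectCells a b then
    p.1 + p.2 + 1 + ((Finset.range c).filter (fun z => D p.1 p.2 z)).card else 0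

lemma mem_rect {a b : ℕ} {i j : ℕ} : (i, j) ∈ rectCells a b ↔ i < a ∧ j < b := by
  simp [rectCells]

lemma card_down (c : ℕ) (P : ℕ → Prop) (h : ∀ z, P (z + 1) → P z) (hs : ∀ z, P z → z < c) (z : ℕ) :
    z < ((Finset.range c).filter P).card ↔ P z := by
  have hd : ∀ n m, n ≤ m → P m → P n := by
    intro n m hnm
    induction m, hnm using Nat.le_induction with
    | base => exact id
    | succ m _ ih => exact fun hp => ih (h m hp)
  have hex : ∃ n, ¬ P n := ⟨c, fun hp => absurd (hs c hp) (lt_irrefl _)⟩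
  have key : ∀ w, P w ↔ w < Nat.find hex := by
    intro w
    constructor
    · intro hp
      by_contra hn
      exact Nat.find_spec hex (hd _ _ (not_lt.mp hn) hp)
    · intro hw
      exact not_not.mp (Nat.find_min hex hw)
  have : (Finset.range c).filter P = Finset.range (Nat.find hex) := by
    ext w
    simp only [Finset.mem_filter, Finset.mem_range]
    rw [← key]
    exact ⟨fun h => h.2, fun h => ⟨hs w h, h⟩⟩
  rw [this, Finset.card_range, key]

lemma tab_gt {a b c : ℕ} {D : ℕ → ℕ → ℕ → Prop} (hD : Low a b c D) {i j : ℕ} (hi : i < a)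
    (hj : j < b) (v : ℕ) :
    v < tab a b c D (i, j) ↔ v < i + j + 1 ∨ ∃ z, v = i + j + 1 + z ∧ D i j z := by
  have := card_down c (fun z => D i j z) (hD.hz i j) (fun z h => (hD.sup i j z h).2.2)
  simp only [tab, mem_rect, hi, hj, and_self, if_true]
  constructor
  · intro h
    by_cases hv : v < i + j + 1
    · exact Or.inl hv
    · refine Or.inr ⟨v - (i + j + 1), by omega, (this _).1 (by omega)⟩
  · rintro (h | ⟨z, rfl, h⟩)
    · omega
    · have := (this z).2 h
      omega

lemma tab_le {a b c : ℕ} {D : ℕ → ℕ → ℕ → Prop} {i j : ℕ} (hi : i < a)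
    (hj : j < b) : i + j + 1 ≤ tab a b c D (i, j) ∧ tab a b c D (i, j) ≤ i + j + 1 + c := by
  simp only [tab, mem_rect, hi, hj, and_self, if_true]
  have := Finset.card_filter_le (Finset.range c) (fun z => D i j z)
  simp only [Finset.card_range] at this
  omega

lemma tab_i {a b c : ℕ} {D : ℕ → ℕ → ℕ → Prop} (hD : Low a b c D) {i j : ℕ} (hi : i + 1 < a)
    (hj : j < b) : tab a b c D (i, j) < tab a b c D (i + 1, j) := by
  rw [tab_gt hD hi hj]
  by_contra hcon
  push Not at hcon
  have h1 := hcon.1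
  have h2 := (tab_gt hD (by omega : i < a) hj (tab a b c D (i, j) - 1)).1 (by omega)
  rcases h2 with h2 | ⟨z, h2, h3⟩
  · omega
  · exact hcon.2 z (by omega) (hD.hi _ _ _ h3 hi)

lemma tab_j {a b c : ℕ} {D : ℕ → ℕ → ℕ → Prop} (hD : Low a b c D) {i j : ℕ} (hi : i < a)
    (hj : j + 1 < b) : tab a b c D (i, j) < tab a b c D (i, j + 1) := by
  rw [tab_gt hD hi hj]
  by_contra hcon
  push Not at hcon
  have h1 := hcon.1
  have h2 := (tab_gt hD hi (by omega : j < b) (tab a b c D (i, j) - 1)).1 (by omega)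
  rcases h2 with h2 | ⟨z, h2, h3⟩
  · omega
  · exact hcon.2 z (by omega) (hD.hj _ _ _ h3 hj)

lemma tab_mem {a b c : ℕ} {D : ℕ → ℕ → ℕ → Prop} (hD : Low a b c D) :
    tab a b c D ∈ IncTabSet a b (a + b + c - 1) := by
  refine ⟨⟨?_, ?_, ?_⟩, ?_⟩
  · rintro ⟨i, j⟩ h
    rw [mem_rect] at h
    have := tab_le (c := c) (D := D) h.1 h.2
    omega
  · rintro ⟨i, j⟩ h ⟨i', j'⟩ h' e hlt
    simp only at e hlt
    subst e
    rw [mem_rect] at h h'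
    obtain ⟨h1, h2⟩ := h'
    clear h
    induction j', hlt using Nat.le_induction with
    | base => exact tab_j hD h1 h2
    | succ m _ ih => exact (ih (by omega)).trans (tab_j hD h1 h2)
  · rintro ⟨i, j⟩ h ⟨i', j'⟩ h' e hlt
    simp only at e hlt
    subst e
    rw [mem_rect] at h h'
    obtain ⟨h1, h2⟩ := h'
    clear h
    induction i', hlt using Nat.le_induction with
    | base => exact tab_i hD h1 h2
    | succ m _ ih => exact (ih (by omega)).trans (tab_i hD h1 h2)
  · intro p hp
    simp [tab, hp]

/-- The intermediate time slices. -/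
def DK (F : ℕ → ℕ → ℕ → ℕ → Prop) (k i j z : ℕ) : Prop :=
  F (if i + j + z + 1 ≤ k then z + 1 else z) i j z

lemma DK_low {a b c : ℕ} {F : ℕ → ℕ → ℕ → ℕ → Prop} (hF : ∀ m, Low a b c (F m))
    (hR : ∀ m, Rule a b c (F m) (F (m + 1))) (k : ℕ) : Low a b c (DK F k) := by
  constructor
  · intro i j z h
    exact (hF _).sup i j z h
  · intro i j z h
    unfold DK at h ⊢
    by_cases c1 : i + j + (z + 1) + 1 ≤ k
    · rw [if_pos c1] at h
      rw [if_pos (by omega)]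
      exact (hR _).bz _ _ _ h
    · rw [if_neg c1] at h
      by_cases c2 : i + j + z + 1 ≤ k
      · rw [if_pos c2]
        exact (hF _).hz _ _ _ h
      · rw [if_neg c2]
        exact (hR _).bz _ _ _ h
  · intro i j z h hi
    unfold DK at h ⊢
    by_cases c1 : i + 1 + j + z + 1 ≤ k
    · rw [if_pos (by omega)] at h
      rw [if_pos c1]
      exact (hF _).hi _ _ _ h hi
    · rw [if_neg c1]
      by_cases c2 : i + j + z + 1 ≤ k
      · rw [if_pos c2] at h
        exact (hR _).bi _ _ _ h hi
      · rw [if_neg c2] at h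
        exact (hF _).hi _ _ _ h hi
  · intro i j z h hj
    unfold DK at h ⊢
    by_cases c1 : i + (j + 1) + z + 1 ≤ k
    · rw [if_pos (by omega)] at h
      rw [if_pos c1]
      exact (hF _).hj _ _ _ h hj
    · rw [if_neg c1]
      by_cases c2 : i + j + z + 1 ≤ k
      · rw [if_pos c2] at h
        exact (hR _).bj _ _ _ h hj
      · rw [if_neg c2] at h
        exact (hF _).hj _ _ _ h hj

lemma adj_iff {a b : ℕ} {S : ℕ × ℕ → ℕ} {i j : ℕ} (hi : i < a) (hj : j < b) (v : ℕ) :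
    (∃ d ∈ rectCells a b, incAdj (i, j) d ∧ S d = v) ↔
      (i + 1 < a ∧ S (i + 1, j) = v) ∨ (j + 1 < b ∧ S (i, j + 1) = v) ∨
      (∃ i', i = i' + 1 ∧ S (i', j) = v) ∨ (∃ j', j = j' + 1 ∧ S (i, j') = v) := by
  constructor
  · rintro ⟨⟨i', j'⟩, hd, hadj, hS⟩
    rw [mem_rect] at hd
    simp only [incAdj] at hadj
    rcases hadj with ⟨rfl, rfl | rfl⟩ | ⟨rfl, rfl | rfl⟩
    · exact Or.inr (Or.inl ⟨hd.2, hS⟩)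
    · exact Or.inr (Or.inr (Or.inr ⟨_, rfl, hS⟩))
    · exact Or.inl ⟨hd.1, hS⟩
    · exact Or.inr (Or.inr (Or.inl ⟨_, rfl, hS⟩))
  · rintro (⟨h, hS⟩ | ⟨h, hS⟩ | ⟨i', rfl, hS⟩ | ⟨j', rfl, hS⟩)
    · exact ⟨(i + 1, j), mem_rect.2 ⟨h, hj⟩, by simp [incAdj], hS⟩
    · exact ⟨(i, j + 1), mem_rect.2 ⟨hi, h⟩, by simp [incAdj], hS⟩
    · exact ⟨(i', j), mem_rect.2 ⟨by omega, hj⟩, by simp [incAdj], hS⟩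
    · exact ⟨(i, j'), mem_rect.2 ⟨hi, by omega⟩, by simp [incAdj], hS⟩

/-- Toggle description of a K-Bender-Knuth step. -/
lemma kbk_gt {a b k : ℕ} {S : ℕ × ℕ → ℕ}
    (h1 : ∀ i j, i + 1 < a → j < b → S (i, j) < S (i + 1, j))
    (h2 : ∀ i j, i < a → j + 1 < b → S (i, j) < S (i, j + 1))
    {i j : ℕ} (hi : i < a) (hj : j < b) (v : ℕ) :
    v < kbkMap (rectCells a b) k S (i, j) ↔
      if v = k then
        ((∃ i', i = i' + 1 ∧ k ≤ S (i', j)) ∨ (∃ j', j = j' + 1 ∧ k ≤ S (i, j')) ∨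
          k + 1 < S (i, j) ∨ (S (i, j) = k ∧ (i + 1 < a → k + 1 < S (i + 1, j)) ∧
            (j + 1 < b → k + 1 < S (i, j + 1))))
      else v < S (i, j) := by
  have e1 : (∃ d ∈ rectCells a b, incAdj (i, j) d ∧ S d = k + 1) ↔
      (i + 1 < a ∧ S (i + 1, j) = k + 1) ∨ (j + 1 < b ∧ S (i, j + 1) = k + 1) ∨
      (∃ i', i = i' + 1 ∧ S (i', j) = k + 1) ∨ (∃ j', j = j' + 1 ∧ S (i, j') = k + 1) := by
    exact adj_iff hi hj _
  have e2 : (∃ d ∈ rectCells a b, incAdj (i, j) d ∧ S d = k) ↔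
      (i + 1 < a ∧ S (i + 1, j) = k) ∨ (j + 1 < b ∧ S (i, j + 1) = k) ∨
      (∃ i', i = i' + 1 ∧ S (i', j) = k) ∨ (∃ j', j = j' + 1 ∧ S (i, j') = k) := by
    exact adj_iff hi hj _
  unfold kbkMap
  simp only [e1, e2, mem_rect, hi, hj, and_self, true_and]
  clear e1 e2
  have h1' := h1 i j
  have h2' := h2 i j
  have ex0 : ∀ P : ℕ → Prop, (∃ n, 0 = n + 1 ∧ P n) ↔ False := by
    intro P; constructor
    · rintro ⟨n, h, _⟩; omega
    · exact False.elim
  have ex1 : ∀ (m : ℕ) (P : ℕ → Prop), (∃ n, m + 1 = n + 1 ∧ P n) ↔ P m := by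
    intro m P; constructor
    · rintro ⟨n, h, hp⟩
      obtain rfl : m = n := by omega
      exact hp
    · intro h; exact ⟨m, rfl, h⟩
  rcases i with _ | i <;> rcases j with _ | j
  · simp only [ex0, false_or, or_false, zero_add] at h1' h2' ⊢
    clear ex0 ex1 h1 h2
    split_ifs <;> omega
  · have := h2 0 j
    simp only [ex0, ex1, false_or, or_false, zero_add] at this h1' h2' ⊢
    clear ex0 ex1 h1 h2
    split_ifs <;> omega
  · have := h1 i 0
    simp only [ex0, ex1, false_or, or_false, zero_add] at this h1' h2' ⊢
    clear ex0 ex1 h1 h2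
    split_ifs <;> omega
  · have := h1 i (j + 1)
    have := h2 (i + 1) j
    simp only [ex1]
    clear ex0 ex1 h1 h2
    split_ifs <;> omega

lemma step {a b c : ℕ} {F : ℕ → ℕ → ℕ → ℕ → Prop} (hF : ∀ m, Low a b c (F m))
    (hR : ∀ m, Rule a b c (F m) (F (m + 1))) (k : ℕ) (hk : k + 1 < a + b + c - 1) :
    kbkMap (rectCells a b) (k + 1) (tab a b c (DK F k)) = tab a b c (DK F (k + 1)) := by
  have hL := DK_low hF hR k
  have hL' := DK_low hF hR (k + 1)
  funext ⟨i, j⟩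
  by_cases hmem : (i, j) ∈ rectCells a b
  swap
  · simp [kbkMap, tab, hmem]
  obtain ⟨hi, hj⟩ := mem_rect.1 hmem
  refine eq_of_forall_lt_iff fun v => ?_
  rw [kbk_gt (fun i j h h' => tab_i hL h h') (fun i j h h' => tab_j hL h h') hi hj]
  split_ifs with hv
  swap
  · rw [tab_gt hL hi hj, tab_gt hL' hi hj]
    refine or_congr Iff.rfl (exists_congr fun z => and_congr_right fun hz => ?_)
    unfold DK
    have : (i + j + z + 1 ≤ k) ↔ (i + j + z + 1 ≤ k + 1) := by omega
    simp only [this]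
  subst hv
  have hle := tab_le (c := c) (D := DK F k) hi hj
  rw [tab_gt hL' hi hj]
  by_cases hlow : k + 1 < i + j + 1
  · simp only [hlow, true_or, iff_true]
    rcases i with _ | i
    · rcases j with _ | j
      · omega
      · have := tab_le (c := c) (D := DK F k) hi (by omega : j < b)
        exact Or.inr (Or.inl ⟨j, rfl, by omega⟩)
    · have := tab_le (c := c) (D := DK F k) (by omega : i < a) hj
      exact Or.inl ⟨i, rfl, by omega⟩
  simp only [hlow, false_or]
  obtain ⟨z, hz⟩ : ∃ z, k + 1 = i + j + 1 + z := ⟨k - (i + j), by omega⟩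
  have hex : (∃ z, k + 1 = i + j + 1 + z ∧ DK F (k + 1) i j z) ↔ F (z + 1) i j z := by
    constructor
    · rintro ⟨z', h, h'⟩
      obtain rfl : z' = z := by omega
      unfold DK at h'
      rwa [if_pos (by omega)] at h'
    · intro h
      refine ⟨z, hz, ?_⟩
      unfold DK
      rwa [if_pos (by omega)]
  rw [hex]
  by_cases hzc : z < c
  swap
  · have hn : ¬ F (z + 1) i j z := fun h => hzc ((hF _).sup _ _ _ h).2.2
    simp only [hn, iff_false]
    rintro (⟨i', rfl, h⟩ | ⟨j', rfl, h⟩ | h | ⟨h, h', h''⟩)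
    · have := tab_le (c := c) (D := DK F k) (by omega : i' < a) hj
      omega
    · have := tab_le (c := c) (D := DK F k) hi (by omega : j' < b)
      omega
    · omega
    · by_cases hia : i + 1 < a
      · have := tab_le (c := c) (D := DK F k) hia hj
        have := h' hia
        clear h' h''
        omega
      · by_cases hjb : j + 1 < b
        · have := tab_le (c := c) (D := DK F k) hi hjb
          have := h'' hjb
          clear h' h''
          omega
        · clear h' h''
          omega
  rw [(hR z).rule i j z hi hj hzc]
  -- translate each piece
  have trans : ∀ i' j' z' m, i' < a → j' < b → (m = if i' + j' + z' + 1 ≤ k then z' + 1 else z') →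
      (i' + j' + 1 + z' < tab a b c (DK F k) (i', j') ↔ F m i' j' z') := by
    intro i' j' z' m hi' hj' hm
    rw [tab_gt hL hi' hj']
    constructor
    · rintro (h | ⟨w, h, h'⟩)
      · omega
      · obtain rfl : w = z' := by omega
        unfold DK at h'
        rwa [hm]
    · intro h
      refine Or.inr ⟨z', rfl, ?_⟩
      unfold DK
      rwa [← hm]
  refine or_congr ?_ (or_congr ?_ (or_congr ?_ ?_))
  · refine exists_congr fun i' => and_congr_right fun h => ?_
    rw [← trans i' j z (z + 1) (by omega) hj (by rw [if_pos (by omega)])]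
    constructor <;> intro <;> omega
  · refine exists_congr fun j' => and_congr_right fun h => ?_
    rw [← trans i j' z (z + 1) hi (by omega) (by rw [if_pos (by omega)])]
    constructor <;> intro <;> omega
  · rw [← trans i j (z + 1) (z + 1) hi hj (by rw [if_neg (by omega)])]
    constructor <;> intro <;> omega
  · rw [← trans i j z z hi hj (by rw [if_neg (by omega)])]
    have e1 : (i + 1 < a → k + 1 + 1 < tab a b c (DK F k) (i + 1, j)) ↔
        (i + 1 < a → F z (i + 1) j z) := by
      refine forall_congr' fun h => ?_
      rw [← trans (i + 1) j z z h hj (by rw [if_neg (by omega)])]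
      constructor <;> intro <;> omega
    have e2 : (j + 1 < b → k + 1 + 1 < tab a b c (DK F k) (i, j + 1)) ↔
        (j + 1 < b → F z i (j + 1) z) := by
      refine forall_congr' fun h => ?_
      rw [← trans i (j + 1) z z hi h (by rw [if_neg (by omega)])]
      constructor <;> intro <;> omega
    have e3 : (∀ z', z = z' + 1 → F z i j z') ↔ k + 1 ≤ tab a b c (DK F k) (i, j) := by
      rcases z with _ | z
      · constructor
        · intro; omega
        · intro _ z' h; omega
      · have := trans i j z (z + 1) hi hj (by rw [if_pos (by omega)])
        constructor
        · intro h
          have := this.2 (h z rfl)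
          omega
        · intro h z' hz'
          obtain rfl : z = z' := by omega
          exact this.1 (by omega)
    rw [e1, e2, e3]
    constructor
    · rintro ⟨h, h', h''⟩
      exact ⟨by omega, h', h'', by omega⟩
    · rintro ⟨h, h', h'', h3⟩
      exact ⟨by omega, h', h''⟩

lemma promo {a b c : ℕ} {F : ℕ → ℕ → ℕ → ℕ → Prop} (hF : ∀ m, Low a b c (F m))
    (hR : ∀ m, Rule a b c (F m) (F (m + 1))) :
    kPromo (rectCells a b) (a + b + c - 1) (tab a b c (DK F 0)) =
      tab a b c (fun i j z => F (z + 1) i j z) := by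
  have key : ∀ k, k ≤ a + b + c - 1 - 1 →
      (List.range k).foldl (fun S k => kbkMap (rectCells a b) (k + 1) S) (tab a b c (DK F 0)) =
        tab a b c (DK F k) := by
    intro k
    induction k with
    | zero => intro _; rfl
    | succ k ih =>
      intro hk
      rw [List.range_succ, List.foldl_append, ih (by omega)]
      exact step hF hR k (by omega)
  unfold kPromo
  rw [key _ le_rfl]
  congr 1
  funext i j z
  unfold DK
  split_ifs with h
  · rfl
  · apply propext
    constructor
    · intro h'
      have := (hF _).sup _ _ _ h'
      omega
    · intro h'
      have := (hF _).sup _ _ _ h'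
      omega

section ideals
variable {a b c : ℕ}

lemma FF_low {I : Set (Fin a × Fin b × Fin c)} (hI : IsLowerSet I) : Low a b c (FF I) := by
  constructor
  · rintro i j z ⟨hi, hj, hz, _⟩
    exact ⟨hi, hj, hz⟩
  · rintro i j z ⟨hi, hj, hz, h⟩
    refine ⟨hi, hj, by omega, hI ?_ h⟩
    simp [Prod.le_def, Fin.le_def]
  · rintro i j z ⟨hi, hj, hz, h⟩ h1
    refine ⟨h1, hj, hz, hI ?_ h⟩
    simp [Prod.le_def, Fin.le_def]
    omega
  · rintro i j z ⟨hi, hj, hz, h⟩ h1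
    refine ⟨hi, h1, hz, hI ?_ h⟩
    simp [Prod.le_def, Fin.le_def]
    omega

lemma rowmo_lower {P : Type*} [PartialOrder P] (I : Set P) : IsLowerSet (rowmo I) := by
  rintro x y hyx ⟨m, hm, hxm⟩
  exact ⟨m, hm, hyx.trans hxm⟩

lemma rowmo_below {P : Type*} [PartialOrder P] {I : Set P} {x y : P} (hx : x ∈ rowmo I)
    (h : y < x) : y ∈ I := by
  obtain ⟨m, hm, hxm⟩ := hx
  by_contra hy
  have := hm.2 hy (h.le.trans hxm)
  exact absurd (h.trans_le hxm) (not_lt_of_ge this)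

lemma rowmo_inj {P : Type*} [PartialOrder P] [Finite P] {I J : Set P} (hI : IsLowerSet I)
    (hJ : IsLowerSet J) (h : rowmo I = rowmo J) : I = J := by
  have key : ∀ I J : Set P, IsLowerSet I → IsLowerSet J → rowmo I = rowmo J → I ⊆ J := by
    intro I J hI hJ h x hx
    by_contra hxJ
    obtain ⟨m, hmx, hm⟩ := (Set.toFinite {y | y ∉ J}).exists_le_minimal hxJ
    have hmr : m ∈ rowmo I := by
      rw [h]; exact ⟨m, hm, le_rfl⟩
    obtain ⟨n, hn, hmn⟩ := hmr
    have hnr : n ∈ rowmo J := by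
      rw [← h]; exact ⟨n, hn, le_rfl⟩
    rcases hmn.eq_or_lt with e | hlt
    · subst e
      exact hn.1 (hI hmx hx)
    · exact hm.1 (rowmo_below hnr hlt)
  exact Set.Subset.antisymm (key I J hI hJ h) (key J I hJ hI h.symm)

lemma FF_rule {I : Set (Fin a × Fin b × Fin c)} (hI : IsLowerSet I) :
    Rule a b c (FF I) (FF (rowmo I)) := by
  have hL := FF_low (rowmo_lower I)
  constructor
  · rintro i j z ⟨hi, hj, hz, h⟩
    refine ⟨hi, hj, by omega, rowmo_below h ?_⟩
    simp [Prod.lt_iff, Prod.le_def, Fin.le_def, Fin.lt_def]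
  · rintro i j z ⟨hi, hj, hz, h⟩ h1
    refine ⟨h1, hj, hz, rowmo_below h ?_⟩
    simp [Prod.lt_iff, Prod.le_def, Fin.le_def, Fin.lt_def]
    omega
  · rintro i j z ⟨hi, hj, hz, h⟩ h1
    refine ⟨hi, h1, hz, rowmo_below h ?_⟩
    simp [Prod.lt_iff, Prod.le_def, Fin.le_def, Fin.lt_def]
    omega
  · intro i j z hi hj hz
    constructor
    · rintro ⟨_, _, _, h⟩
      obtain ⟨⟨⟨x, hx⟩, ⟨y, hy⟩, ⟨w, hw⟩⟩, hm, hle⟩ := h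
      have hr : (⟨⟨x, hx⟩, ⟨y, hy⟩, ⟨w, hw⟩⟩ : Fin a × Fin b × Fin c) ∈ rowmo I :=
        ⟨_, hm, le_rfl⟩
      simp only [Prod.mk_le_mk, Fin.mk_le_mk] at hle
      obtain ⟨l1, l2, l3⟩ := hle
      by_cases c1 : a - 1 - i < x
      · refine Or.inl ⟨i - 1, by omega, by omega, hj, hz, rowmo_lower I ?_ hr⟩
        simp only [Prod.mk_le_mk, Fin.mk_le_mk]
        omega
      by_cases c2 : b - 1 - j < y
      · refine Or.inr (Or.inl ⟨j - 1, by omega, hi, by omega, hz, rowmo_lower I ?_ hr⟩)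
        simp only [Prod.mk_le_mk, Fin.mk_le_mk]
        omega
      by_cases c3 : z < w
      · refine Or.inr (Or.inr (Or.inl ⟨hi, hj, by omega, rowmo_lower I ?_ hr⟩))
        simp only [Prod.mk_le_mk, Fin.mk_le_mk]
        omega
      obtain rfl : x = a - 1 - i := by omega
      obtain rfl : y = b - 1 - j := by omega
      obtain rfl : w = z := by omega
      refine Or.inr (Or.inr (Or.inr ⟨?_, ?_, ?_, ?_⟩))
      · rintro ⟨_, _, _, h⟩
        exact hm.1 h
      · intro h1
        refine ⟨h1, hj, hz, rowmo_below hr ?_⟩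
        simp [Prod.lt_iff, Prod.le_def, Fin.le_def, Fin.lt_def]
        omega
      · intro h1
        refine ⟨hi, h1, hz, rowmo_below hr ?_⟩
        simp [Prod.lt_iff, Prod.le_def, Fin.le_def, Fin.lt_def]
        omega
      · rintro z' rfl
        refine ⟨hi, hj, by omega, rowmo_below hr ?_⟩
        simp [Prod.lt_iff, Prod.le_def, Fin.le_def, Fin.lt_def]
    · rintro (⟨i', rfl, h⟩ | ⟨j', rfl, h⟩ | h | ⟨h0, h1, h2, h3⟩)
      · exact hL.hi _ _ _ h hi
      · exact hL.hj _ _ _ h hj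
      · exact hL.hz _ _ _ h
      · refine ⟨hi, hj, hz, _, ⟨fun h => h0 ⟨hi, hj, hz, h⟩, ?_⟩, le_rfl⟩
        rintro ⟨⟨x, hx⟩, ⟨y, hy⟩, ⟨w, hw⟩⟩ hn hle
        simp only [Prod.mk_le_mk, Fin.mk_le_mk] at hle ⊢
        obtain ⟨l1, l2, l3⟩ := hle
        by_contra hcon
        apply hn
        by_cases c1 : x < a - 1 - i
        · obtain ⟨_, _, _, h⟩ := h1 (by omega)
          refine hI ?_ h
          simp only [Prod.mk_le_mk, Fin.mk_le_mk]
          omega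
        by_cases c2 : y < b - 1 - j
        · obtain ⟨_, _, _, h⟩ := h2 (by omega)
          refine hI ?_ h
          simp only [Prod.mk_le_mk, Fin.mk_le_mk]
          omega
        obtain ⟨_, _, _, h⟩ := h3 (z - 1) (by omega)
        refine hI ?_ h
        simp only [Prod.mk_le_mk, Fin.mk_le_mk]
        omega

/-- The tilted ideal. -/
def gm (I : Set (Fin a × Fin b × Fin c)) : Set (Fin a × Fin b × Fin c) :=
  {p | p ∈ rowmo^[p.2.2.val] I}

lemma iter_lower {I : Set (Fin a × Fin b × Fin c)} (hI : IsLowerSet I) (m : ℕ) :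
    IsLowerSet (rowmo^[m] I) := by
  induction m with
  | zero => exact hI
  | succ m _ => rw [Function.iterate_succ_apply']; exact rowmo_lower _

lemma iter_rule {I : Set (Fin a × Fin b × Fin c)} (hI : IsLowerSet I) (m : ℕ) :
    Rule a b c (FF (rowmo^[m] I)) (FF (rowmo^[m + 1] I)) := by
  rw [Function.iterate_succ_apply']; exact FF_rule (iter_lower hI m)

lemma FF_gm (I : Set (Fin a × Fin b × Fin c)) (i j z : ℕ) :
    FF (gm I) i j z ↔ FF (rowmo^[z] I) i j z := Iff.rfl

lemma mem_FF (I : Set (Fin a × Fin b × Fin c)) (p : Fin a × Fin b × Fin c) :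
    p ∈ I ↔ FF I (a - 1 - p.1) (b - 1 - p.2.1) p.2.2 := by
  obtain ⟨⟨x, hx⟩, ⟨y, hy⟩, ⟨w, hw⟩⟩ := p
  have h1 : a - 1 - (a - 1 - x) = x := by omega
  have h2 : b - 1 - (b - 1 - y) = y := by omega
  simp only [FF, h1, h2]
  constructor
  · intro h
    exact ⟨by omega, by omega, hw, h⟩
  · rintro ⟨_, _, _, h⟩
    exact h

lemma FF_inj {I J : Set (Fin a × Fin b × Fin c)} (h : ∀ i j z, FF I i j z ↔ FF J i j z) :
    I = J := by
  ext p
  rw [mem_FF, mem_FF, h]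

lemma lower_of_low {I : Set (Fin a × Fin b × Fin c)} (h : Low a b c (FF I)) : IsLowerSet I := by
  have hz : ∀ n i j z, FF I i j (z + n) → FF I i j z := by
    intro n
    induction n with
    | zero => intro i j z h; exact h
    | succ n ih => intro i j z h'; exact ih _ _ _ (h.hz _ _ _ h')
  have hi : ∀ n i j z, FF I i j z → i + n < a → FF I (i + n) j z := by
    intro n
    induction n with
    | zero => intro i j z h _; exact h
    | succ n ih => intro i j z h' hn; exact h.hi _ _ _ (ih _ _ _ h' (by omega)) hn
  have hj : ∀ n i j z, FF I i j z → j + n < b → FF I i (j + n) z := by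
    intro n
    induction n with
    | zero => intro i j z h _; exact h
    | succ n ih => intro i j z h' hn; exact h.hj _ _ _ (ih _ _ _ h' (by omega)) hn
  rintro ⟨⟨x, hx⟩, ⟨y, hy⟩, ⟨w, hw⟩⟩ ⟨⟨x', hx'⟩, ⟨y', hy'⟩, ⟨w', hw'⟩⟩ hle hm
  simp only [Prod.mk_le_mk, Fin.mk_le_mk] at hle
  rw [mem_FF] at hm ⊢
  simp only at hm ⊢
  have s1 := hi (x - x') _ _ _ hm (by omega)
  have s2 := hj (y - y') _ _ _ s1 (by omega)
  have s3 := hz (w - w') _ _ w' (by rwa [show w' + (w - w') = w by omega])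
  rwa [show a - 1 - x + (x - x') = a - 1 - x' by omega,
    show b - 1 - y + (y - y') = b - 1 - y' by omega] at s3

lemma gm_lower {I : Set (Fin a × Fin b × Fin c)} (hI : IsLowerSet I) : IsLowerSet (gm I) := by
  apply lower_of_low
  have := DK_low (fun m => FF_low (iter_lower hI m)) (iter_rule hI) 0
  exact this

lemma tab_inj {I J : Set (Fin a × Fin b × Fin c)} (hI : IsLowerSet I) (hJ : IsLowerSet J)
    (h : tab a b c (FF I) = tab a b c (FF J)) : I = J := by
  apply FF_inj
  intro i j z
  by_cases hij : i < a ∧ j < b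
  swap
  · constructor
    · rintro ⟨h1, h2, _⟩; exact absurd ⟨h1, h2⟩ hij
    · rintro ⟨h1, h2, _⟩; exact absurd ⟨h1, h2⟩ hij
  have key : ∀ K : Set (Fin a × Fin b × Fin c), IsLowerSet K →
      (FF K i j z ↔ i + j + 1 + z < tab a b c (FF K) (i, j)) := by
    intro K hK
    rw [tab_gt (FF_low hK) hij.1 hij.2]
    constructor
    · intro h; exact Or.inr ⟨z, rfl, h⟩
    · rintro (h | ⟨w, h, h'⟩)
      · omega
      · obtain rfl : w = z := by omega
        exact h'
  rw [key I hI, key J hJ, h]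

lemma equiv {I : Set (Fin a × Fin b × Fin c)} (hI : IsLowerSet I) :
    tab a b c (FF (gm (rowmo I))) =
      kPromo (rectCells a b) (a + b + c - 1) (tab a b c (FF (gm I))) := by
  exact (promo (fun m => FF_low (iter_lower hI m)) (iter_rule hI)).symm

lemma gm_inj {I J : Set (Fin a × Fin b × Fin c)} (hI : IsLowerSet I) (hJ : IsLowerSet J)
    (h : gm I = gm J) : I = J := by
  have h1 : ∀ n, gm (rowmo^[n] I) = gm (rowmo^[n] J) := by
    intro n
    induction n with
    | zero => exact h
    | succ n ih =>
      rw [Function.iterate_succ_apply', Function.iterate_succ_apply']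
      apply tab_inj (gm_lower (rowmo_lower _)) (gm_lower (rowmo_lower _))
      rw [equiv (iter_lower hI n), equiv (iter_lower hJ n), ih]
  have h2 : rowmo^[c] I = rowmo^[c] J := by
    ext p
    have hlt := p.2.2.isLt
    have key : ∀ K : Set (Fin a × Fin b × Fin c),
        p ∈ rowmo^[c] K ↔ p ∈ gm (rowmo^[c - p.2.2.val] K) := by
      intro K
      show _ ↔ p ∈ rowmo^[p.2.2.val] _
      rw [← Function.iterate_add_apply, show p.2.2.val + (c - p.2.2.val) = c by omega]
    rw [key I, key J, h1]
  have h3 : ∀ n, rowmo^[n] I = rowmo^[n] J → I = J := by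
    intro n
    induction n with
    | zero => exact id
    | succ n ih =>
      intro h
      rw [Function.iterate_succ_apply', Function.iterate_succ_apply'] at h
      exact ih (rowmo_inj (iter_lower hI n) (iter_lower hJ n) h)
  exact h3 c h2

lemma tab_surj {T : ℕ × ℕ → ℕ} (hT : T ∈ IncTabSet a b (a + b + c - 1)) :
    ∃ I : Set (Fin a × Fin b × Fin c), IsLowerSet I ∧ tab a b c (FF I) = T := by
  obtain ⟨⟨hr, hrow, hcol⟩, h0⟩ := hT
  have ti : ∀ i j, i + 1 < a → j < b → T (i, j) < T (i + 1, j) := by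
    intro i j hi hj
    exact hcol _ (mem_rect.2 ⟨by omega, hj⟩) _ (mem_rect.2 ⟨hi, hj⟩) rfl (by simp)
  have tj : ∀ i j, i < a → j + 1 < b → T (i, j) < T (i, j + 1) := by
    intro i j hi hj
    exact hrow _ (mem_rect.2 ⟨hi, by omega⟩) _ (mem_rect.2 ⟨hi, hj⟩) rfl (by simp)
  have lo : ∀ n i j, i + j = n → i < a → j < b → i + j + 1 ≤ T (i, j) := by
    intro n
    induction n with
    | zero => intro i j h hi hj; have := hr _ (mem_rect.2 ⟨hi, hj⟩); omega
    | succ n ih =>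
      intro i j h hi hj
      rcases i with _ | i
      · rcases j with _ | j
        · omega
        · have := ih 0 j (by omega) hi (by omega)
          have := tj 0 j hi hj
          omega
      · have := ih i j (by omega) (by omega) hj
        have := ti i j hi hj
        omega
  have up : ∀ n i j, i + j + n + 2 = a + b → i < a → j < b → T (i, j) ≤ i + j + 1 + c := by
    intro n
    induction n with
    | zero => intro i j h hi hj; have := hr _ (mem_rect.2 ⟨hi, hj⟩); omega
    | succ n ih =>
      intro i j h hi hj
      by_cases c1 : i + 1 < a
      · have := ih (i + 1) j (by omega) c1 hj
        have := ti i j c1 hj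
        omega
      · have := ih i (j + 1) (by omega) hi (by omega)
        have := tj i j hi (by omega)
        omega
  let I : Set (Fin a × Fin b × Fin c) :=
    {p | (a - 1 - p.1.val) + (b - 1 - p.2.1.val) + 1 + p.2.2.val <
      T (a - 1 - p.1.val, b - 1 - p.2.1.val)}
  have hFF : ∀ i j z, FF I i j z ↔ i < a ∧ j < b ∧ z < c ∧ i + j + 1 + z < T (i, j) := by
    intro i j z
    constructor
    · rintro ⟨hi, hj, hz, h⟩
      simp only [I, Set.mem_ofPred_eq, show a - 1 - (a - 1 - i) = i by omega,
        show b - 1 - (b - 1 - j) = j by omega] at h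
      exact ⟨hi, hj, hz, h⟩
    · rintro ⟨hi, hj, hz, h⟩
      refine ⟨hi, hj, hz, ?_⟩
      simp only [I, Set.mem_ofPred_eq, show a - 1 - (a - 1 - i) = i by omega,
        show b - 1 - (b - 1 - j) = j by omega]
      exact h
  have hL : Low a b c (FF I) := by
    constructor
    · intro i j z h
      rw [hFF] at h
      omega
    · intro i j z h
      rw [hFF] at h ⊢
      omega
    · intro i j z h h1
      rw [hFF] at h ⊢
      have := ti i j h1 h.2.1
      omega
    · intro i j z h h1
      rw [hFF] at h ⊢
      have := tj i j h.1 h1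
      omega
  refine ⟨I, lower_of_low hL, ?_⟩
  funext ⟨i, j⟩
  by_cases hm : (i, j) ∈ rectCells a b
  · obtain ⟨hi, hj⟩ := mem_rect.1 hm
    refine eq_of_forall_lt_iff fun v => ?_
    rw [tab_gt hL hi hj]
    have l := lo _ i j rfl hi hj
    have u := up (a + b - 2 - i - j) i j (by omega) hi hj
    constructor
    · rintro (h | ⟨z, rfl, h⟩)
      · omega
      · exact ((hFF _ _ _).1 h).2.2.2
    · intro h
      by_cases hv : v < i + j + 1
      · exact Or.inl hv
      · refine Or.inr ⟨v - (i + j + 1), by omega, (hFF _ _ _).2 ⟨hi, hj, by omega, by omega⟩⟩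
  · rw [h0 _ hm]
    simp [tab, hm]

lemma gm_surj {J : Set (Fin a × Fin b × Fin c)} (hJ : IsLowerSet J) :
    ∃ I : Set (Fin a × Fin b × Fin c), IsLowerSet I ∧ gm I = J := by
  let g : {I : Set (Fin a × Fin b × Fin c) // IsLowerSet I} →
      {I : Set (Fin a × Fin b × Fin c) // IsLowerSet I} := fun I => ⟨gm I.1, gm_lower I.2⟩
  have hg : Function.Injective g := by
    intro I K h
    exact Subtype.ext (gm_inj I.2 K.2 (congrArg Subtype.val h))
  obtain ⟨I, hI⟩ := Finite.surjective_of_injective hg ⟨J, hJ⟩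
  exact ⟨I.1, I.2, congrArg Subtype.val hI⟩

end ideals

end RowK

/-- Theorem 4.4: `J(𝐚 × 𝐛 × 𝐜)` under rowmotion is in equivariant bijection
with `Inc^{a+b+c-1}(a×b)` under K-promotion. -/
theorem rowmotion_equivariant_kpromotion (a b c : ℕ)
    (ha : 0 < a) (hb : 0 < b) (hc : 0 < c) :
    ∃ φ : Set (Fin a × Fin b × Fin c) → (ℕ × ℕ → ℕ),
      Set.BijOn φ {I : Set (Fin a × Fin b × Fin c) | IsLowerSet I}
        (IncTabSet a b (a + b + c - 1)) ∧
      ∀ I : Set (Fin a × Fin b × Fin c), IsLowerSet I →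
        φ (rowmo I) = kPromo (rectCells a b) (a + b + c - 1) (φ I) := by
  refine ⟨fun I => RowK.tab a b c (RowK.FF (RowK.gm I)), ⟨?_, ?_, ?_⟩, ?_⟩
  · intro I hI
    exact RowK.tab_mem (RowK.FF_low (RowK.gm_lower hI))
  · intro I hI J hJ h
    exact RowK.gm_inj hI hJ (RowK.tab_inj (RowK.gm_lower hI) (RowK.gm_lower hJ) h)
  · intro T hT
    obtain ⟨J, hJ, rfl⟩ := RowK.tab_surj hT
    obtain ⟨I, hI, rfl⟩ := RowK.gm_surj hJ
    exact ⟨I, hI, rfl⟩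
  · intro I hI
    exact RowK.equiv hI
end

section
/- Let a, b, c be positive integers and q = a+b+c−1. Then there exist K-promotion-equivariant bijections between the sets Inc^q(a×b), Inc^q(a×c), and Inc^q(b×c); that is, there exist bijections φ : Inc^q(a×b) → Inc^q(a×c) and ψ : Inc^q(a×b) → Inc^q(b×c) satisfying φ ∘ ∂ = ∂ ∘ φ and ψ ∘ ∂ = ∂ ∘ ψ. -/
open scoped Classical

/-! ### Toggles on order ideals -/

section Toggle

variable {P : Type} [PartialOrder P]

/-- Toggle of an order ideal at an element. -/
def tog (p : P) (I : LowerSet P) : LowerSet P where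
  carrier := {x | (x ≠ p ∧ x ∈ I) ∨ (x = p ∧ (∀ y, y < p → y ∈ I) ∧ (p ∉ I ∨ ∃ y, p < y ∧ y ∈ I))}
  lower' := by
    intro x z hzx hx
    rcases eq_or_lt_of_le hzx with rfl | hlt
    · exact hx
    rcases hx with ⟨hxp, hxI⟩ | ⟨rfl, h1, h2⟩
    · have hz : z ∈ I := I.lower hzx hxI
      by_cases hzp : z = p
      · subst hzp
        exact Or.inr ⟨rfl, fun y hy => I.lower hy.le hz, Or.inr ⟨x, hlt, hxI⟩⟩
      · exact Or.inl ⟨hzp, hz⟩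
    · exact Or.inl ⟨hlt.ne, h1 z hlt⟩

theorem mem_tog {p x : P} {I : LowerSet P} : x ∈ tog p I ↔
    (x ≠ p ∧ x ∈ I) ∨ (x = p ∧ (∀ y, y < p → y ∈ I) ∧ (p ∉ I ∨ ∃ y, p < y ∧ y ∈ I)) := Iff.rfl

theorem mem_tog_ne {p x : P} {I : LowerSet P} (h : x ≠ p) : x ∈ tog p I ↔ x ∈ I := by
  rw [mem_tog]; tauto

theorem mem_tog_self {p : P} {I : LowerSet P} : p ∈ tog p I ↔
    ((∀ y, y < p → y ∈ I) ∧ (p ∉ I ∨ ∃ y, p < y ∧ y ∈ I)) := by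
  rw [mem_tog]; tauto

theorem tog_tog (p : P) (I : LowerSet P) : tog p (tog p I) = I := by
  ext x
  change x ∈ tog p (tog p I) ↔ x ∈ I
  by_cases hx : x = p
  · subst hx
    have h1 : (∀ y, y < x → y ∈ tog x I) ↔ (∀ y, y < x → y ∈ I) :=
      forall₂_congr fun y hy => mem_tog_ne hy.ne
    have h2 : (∃ y, x < y ∧ y ∈ tog x I) ↔ (∃ y, x < y ∧ y ∈ I) :=
      exists_congr fun y => and_congr_right fun hy => mem_tog_ne hy.ne'
    rw [mem_tog_self, h1, h2, mem_tog_self]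
    have h3 : x ∈ I → ∀ y, y < x → y ∈ I := fun h y hy => I.lower hy.le h
    have h4 : (∃ y, x < y ∧ y ∈ I) → x ∈ I := fun ⟨y, hy, h⟩ => I.lower hy.le h
    clear h1 h2
    generalize (∀ y, y < x → y ∈ I) = A at *
    generalize (∃ y, x < y ∧ y ∈ I) = B at *
    tauto
  · rw [mem_tog_ne hx, mem_tog_ne hx]

/-- Toggle as a permutation. -/
def togP (p : P) : Equiv.Perm (LowerSet P) := Function.Involutive.toPerm (tog p) (tog_tog p)

@[simp] theorem togP_apply (p : P) (I : LowerSet P) : togP p I = tog p I := rfl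

/-- Adjacency in the Hasse diagram. -/
def hAdj (p r : P) : Prop := p ⋖ r ∨ r ⋖ p

theorem tog_self_congr {p r : P} (hpr : p ≠ r) (h : ¬ hAdj p r) (I : LowerSet P) :
    r ∈ tog r (tog p I) ↔ r ∈ tog r I := by
  rw [mem_tog_self, mem_tog_self, mem_tog_ne hpr.symm]
  have hA : (∀ y, y < r → y ∈ tog p I) ↔ (∀ y, y < r → y ∈ I) := by
    by_cases hlt : p < r
    · obtain ⟨s, hps, hsr⟩ : ∃ s, p < s ∧ s < r := by
        by_contra hcon
        push Not at hcon
        exact h (Or.inl ⟨hlt, fun s h1 h2 => hcon s h1 h2⟩)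
      constructor
      · intro hy y hyr
        have hs := (mem_tog_ne hps.ne').1 (hy s hsr)
        by_cases hyp : y = p
        · subst hyp; exact I.lower hps.le hs
        · exact (mem_tog_ne hyp).1 (hy y hyr)
      · intro hy y hyr
        by_cases hyp : y = p
        · subst hyp
          exact mem_tog_self.2 ⟨fun z hz => hy z (hz.trans hlt), Or.inr ⟨s, hps, hy s hsr⟩⟩
        · exact (mem_tog_ne hyp).2 (hy y hyr)
    · refine forall₂_congr fun y hy => mem_tog_ne ?_
      rintro rfl; exact hlt hy
  have hB : (∃ y, r < y ∧ y ∈ tog p I) ↔ (∃ y, r < y ∧ y ∈ I) := by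
    by_cases hlt : r < p
    · obtain ⟨s, hrs, hsp⟩ : ∃ s, r < s ∧ s < p := by
        by_contra hcon
        push Not at hcon
        exact h (Or.inr ⟨hlt, fun s h1 h2 => hcon s h1 h2⟩)
      constructor
      · rintro ⟨y, hy, hm⟩
        by_cases hyp : y = p
        · subst hyp; exact ⟨s, hrs, (mem_tog_self.1 hm).1 s hsp⟩
        · exact ⟨y, hy, (mem_tog_ne hyp).1 hm⟩
      · rintro ⟨y, hy, hm⟩
        by_cases hyp : y = p
        · subst hyp; exact ⟨s, hrs, (mem_tog_ne hsp.ne).2 (I.lower hsp.le hm)⟩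
        · exact ⟨y, hy, (mem_tog_ne hyp).2 hm⟩
    · refine exists_congr fun y => and_congr_right fun hy => mem_tog_ne ?_
      rintro rfl; exact hlt hy
  rw [hA, hB]

theorem hAdj_symm {p r : P} (h : hAdj p r) : hAdj r p := Or.symm h

theorem hAdj_irrefl (p : P) : ¬ hAdj p p := by
  rintro (h | h) <;> exact h.1.ne rfl

theorem togP_commute (p r : P) (h : ¬ hAdj p r) : Commute (togP p) (togP r) := by
  by_cases hpr : p = r
  · subst hpr; exact Commute.refl _
  apply Equiv.ext
  intro I
  change tog p (tog r I) = tog r (tog p I)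
  ext x
  change x ∈ tog p (tog r I) ↔ x ∈ tog r (tog p I)
  by_cases hxp : x = p
  · subst hxp
    rw [tog_self_congr (Ne.symm hpr) (fun h' => h (hAdj_symm h')), mem_tog_ne hpr]
  · by_cases hxr : x = r
    · subst hxr
      rw [tog_self_congr hpr h, mem_tog_ne hxp]
    · rw [mem_tog_ne hxp, mem_tog_ne hxr, mem_tog_ne hxr, mem_tog_ne hxp]

/-- Product of toggles along a list; the last element of the list acts first. -/
def togProd (l : List P) : Equiv.Perm (LowerSet P) := (l.map togP).prod

theorem togProd_cons (v : P) (l : List P) : togProd (v :: l) = togP v * togProd l := by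
  simp [togProd]

theorem togProd_append (l m : List P) : togProd (l ++ m) = togProd l * togProd m := by
  simp [togProd]

theorem togProd_nil : togProd ([] : List P) = 1 := by simp [togProd]

theorem togProd_commute (v : P) (l : List P) (h : ∀ a ∈ l, ¬ hAdj v a) :
    Commute (togP v) (togProd l) := by
  induction l with
  | nil => rw [togProd_nil]; exact Commute.one_right _
  | cons a l ih =>
    rw [togProd_cons]
    exact (togP_commute v a (h a (by simp))).mul_right (ih fun b hb => h b (by simp [hb]))

theorem mem_togProd_notMem (l : List P) (x : P) (h : x ∉ l) (I : LowerSet P) :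
    x ∈ togProd l I ↔ x ∈ I := by
  induction l with
  | nil => rw [togProd_nil]; rfl
  | cons a l ih =>
    simp only [List.mem_cons, not_or] at h
    rw [togProd_cons, Equiv.Perm.mul_apply, togP_apply, mem_tog_ne h.1, ih h.2]

theorem mem_togProd_mem (l : List P) (hn : l.Nodup) (hl : ∀ a ∈ l, ∀ b ∈ l, ¬ hAdj a b)
    (x : P) (h : x ∈ l) (I : LowerSet P) :
    x ∈ togProd l I ↔ x ∈ tog x I := by
  induction l with
  | nil => simp at h
  | cons a l ih =>
    rw [List.nodup_cons] at hn
    by_cases hxa : x = a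
    · subst hxa
      have hc : Commute (togP x) (togProd l) :=
        togProd_commute _ _ fun b hb => hl x (by simp) b (by simp [hb])
      rw [togProd_cons, hc.eq, Equiv.Perm.mul_apply, mem_togProd_notMem _ _ hn.1, togP_apply]
    · rw [togProd_cons, Equiv.Perm.mul_apply, togP_apply, mem_tog_ne hxa]
      refine ih hn.2 (fun b hb d hd => hl b (by simp [hb]) d (by simp [hd])) ?_
      simpa [hxa] using h

/-- A list compatible with a height function. -/
def Compat (f : P → ℤ) (l : List P) : Prop := l.Pairwise fun p r => hAdj p r → f p < f r

theorem togProd_uniq (f : P → ℤ) (l m : List P) (h : l.Perm m) (hl : Compat f l)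
    (hm : Compat f m) : togProd l = togProd m := by
  induction l generalizing m with
  | nil => rw [List.nil_perm.1 h]
  | cons v l ih =>
    obtain ⟨A, B, rfl⟩ := List.append_of_mem (h.mem_iff.1 (List.mem_cons_self : v ∈ v :: l))
    unfold Compat at hl hm
    rw [List.pairwise_cons] at hl
    have hm' := List.pairwise_append.1 hm
    have hcomm : Commute (togP v) (togProd A) := by
      apply togProd_commute
      intro x hx hadj
      have h1 : f x < f v := hm'.2.2 x hx v (by simp) (hAdj_symm hadj)
      have hxl : x ∈ v :: l := h.mem_iff.2 (by simp [hx])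
      rcases List.mem_cons.1 hxl with rfl | hxl
      · exact hAdj_irrefl _ hadj
      · have := hl.1 x hxl hadj
        omega
    have hp : l.Perm (A ++ B) := (h.trans List.perm_middle).cons_inv
    have hAB : Compat f (A ++ B) := hm.sublist (by simp)
    rw [togProd_cons, ih _ hp hl.2 hAB, togProd_append, togProd_append, togProd_cons,
      ← mul_assoc, hcomm.eq, mul_assoc]

/-- Height functions change by exactly one along Hasse edges. -/
def IsHeight (f : P → ℤ) : Prop := ∀ p r, p ⋖ r → f p = f r + 1 ∨ f r = f p + 1

theorem IsHeight.adj {f : P → ℤ} (hf : IsHeight f) {p r : P} (h : hAdj p r) :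
    f p = f r + 1 ∨ f r = f p + 1 := by
  rcases h with h | h
  · exact hf p r h
  · exact (hf r p h).symm

theorem flip_step (f g : P → ℤ) (v : P) (l : List P) (hn : l.Nodup) (hv : v ∈ l)
    (hl : Compat f l) (hmin : ∀ w, hAdj v w → f w = f v + 1)
    (hg : ∀ w, w ≠ v → g w = f w) (hgv : g v = f v + 2) :
    ∃ m, l.Perm m ∧ Compat g m ∧ IsConj (togProd l) (togProd m) := by
  obtain ⟨A, B, rfl⟩ := List.append_of_mem hv
  have hn2 : (v :: (A ++ B)).Nodup := (List.perm_middle.nodup_iff).1 hn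
  rw [List.nodup_cons] at hn2
  have hl' := List.pairwise_append.1 hl
  have hcomm : Commute (togP v) (togProd A) := by
    apply togProd_commute
    intro x hx hadj
    have h1 : f x < f v := hl'.2.2 x hx v (by simp) (hAdj_symm hadj)
    have := hmin x hadj
    omega
  refine ⟨(A ++ B) ++ [v], ?_, ?_, ?_⟩
  · exact List.perm_middle.trans (List.perm_append_singleton _ _).symm
  · unfold Compat
    rw [List.pairwise_append]
    refine ⟨?_, by simp, ?_⟩
    · have hAB : Compat f (A ++ B) := hl.sublist (by simp)
      refine List.Pairwise.imp_of_mem ?_ hAB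
      intro x y hx hy hxy hadj
      rw [hg x (by rintro rfl; exact hn2.1 hx), hg y (by rintro rfl; exact hn2.1 hy)]
      exact hxy hadj
    · intro x hx y hy hadj
      obtain rfl : y = v := by simpa using hy
      rw [hg x (by rintro rfl; exact hn2.1 hx), hgv, hmin x (hAdj_symm hadj)]
      omega
  · rw [isConj_iff]
    refine ⟨(togP v)⁻¹, ?_⟩
    rw [togProd_append, togProd_append, togProd_append, togProd_cons, togProd_cons, togProd_nil,
      ← mul_assoc (togProd A), ← hcomm.eq]
    group

theorem conj_le [Fintype P] (g : P → ℤ) (hg : IsHeight g) (n : ℕ) :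
    ∀ (f : P → ℤ) (_ : IsHeight f) (_ : ∀ p, f p ≤ g p) (_ : ∀ p, 2 ∣ g p - f p)
      (_ : ∑ p, (g p - f p) ≤ n)
      (l : List P) (_ : l.Nodup) (_ : ∀ p, p ∈ l) (_ : Compat f l),
      ∃ m, l.Perm m ∧ Compat g m ∧ IsConj (togProd l) (togProd m) := by
  induction n with
  | zero =>
    intro f hf hle hpar hsum l hn hmem hl
    have h0 : ∀ p ∈ Finset.univ, 0 ≤ g p - f p := fun p _ => by have := hle p; omega
    have hz := (Finset.sum_eq_zero_iff_of_nonneg h0).1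
      (le_antisymm (by simpa using hsum) (Finset.sum_nonneg h0))
    have hfg : f = g := funext fun p => by have := hz p (Finset.mem_univ _); omega
    subst hfg
    exact ⟨l, List.Perm.refl _, hl, IsConj.refl _⟩
  | succ n ih =>
    intro f hf hle hpar hsum l hn hmem hl
    by_cases hfg : ∀ p, f p = g p
    · have hfg : f = g := funext hfg
      subst hfg
      exact ⟨l, List.Perm.refl _, hl, IsConj.refl _⟩
    push Not at hfg
    obtain ⟨v, hv, hvmin⟩ := Finset.exists_min_image (Finset.univ.filter fun p => f p ≠ g p) f
      (by obtain ⟨p, hp⟩ := hfg; exact ⟨p, by simpa using hp⟩)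
    simp only [Finset.mem_filter, Finset.mem_univ, true_and] at hv hvmin
    have hmin : ∀ w, hAdj v w → f w = f v + 1 := by
      intro w hadj
      rcases hf.adj hadj with h | h
      · by_cases hw : f w = g w
        · have h1 := hg.adj hadj
          have h2 := hle v
          have h3 := hpar v
          omega
        · have := hvmin w hw
          omega
      · exact h
    let f' : P → ℤ := fun p => if p = v then f v + 2 else f p
    have hf'v : f' v = f v + 2 := by simp [f']
    have hf'w : ∀ w, w ≠ v → f' w = f w := fun w hw => by simp [f', hw]
    obtain ⟨m, hlm, hm, hc⟩ := flip_step f f' v l hn (hmem v) hl hmin hf'w hf'v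
    have hf' : IsHeight f' := by
      intro p r hpr
      by_cases hp : p = v
      · subst hp
        have := hmin r (Or.inl hpr)
        rw [hf'v, hf'w r hpr.1.ne']; omega
      · by_cases hr : r = v
        · subst hr
          have := hmin p (Or.inr hpr)
          rw [hf'v, hf'w p hp]; omega
        · rw [hf'w p hp, hf'w r hr]; exact hf p r hpr
    have hle' : ∀ p, f' p ≤ g p := by
      intro p
      by_cases hp : p = v
      · subst hp; rw [hf'v]; have := hle p; have := hpar p; omega
      · rw [hf'w p hp]; exact hle p
    have hpar' : ∀ p, 2 ∣ g p - f' p := by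
      intro p
      by_cases hp : p = v
      · subst hp; rw [hf'v]; have := hpar p; omega
      · rw [hf'w p hp]; exact hpar p
    have hlt : ∑ p, (g p - f' p) < ∑ p, (g p - f p) := by
      apply Finset.sum_lt_sum
      · intro p _
        by_cases hp : p = v
        · subst hp; rw [hf'v]; omega
        · rw [hf'w p hp]
      · exact ⟨v, Finset.mem_univ _, by rw [hf'v]; omega⟩
    obtain ⟨m', h1, h2, h3⟩ := ih f' hf' hle' hpar' (by push_cast at hsum; omega) m
      (hlm.nodup_iff.1 hn) (fun p => hlm.mem_iff.1 (hmem p)) hm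
    exact ⟨m', hlm.trans h1, h2, hc.trans h3⟩

theorem conj_main [Fintype P] (f g : P → ℤ) (hf : IsHeight f) (hg : IsHeight g)
    (hpar : ∀ p, 2 ∣ g p - f p) (l m : List P) (hl : l.Nodup) (hm : m.Nodup)
    (hl' : ∀ p, p ∈ l) (hm' : ∀ p, p ∈ m) (hlc : Compat f l) (hmc : Compat g m) :
    IsConj (togProd l) (togProd m) := by
  set N : ℤ := ∑ p, |g p - f p| with hN
  have hNp : ∀ p, |g p - f p| ≤ N := fun p =>
    Finset.single_le_sum (f := fun p => |g p - f p|) (fun _ _ => abs_nonneg _) (Finset.mem_univ p)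
  let f' : P → ℤ := fun p => f p - 2 * N
  have hf' : IsHeight f' := by
    intro p r h
    have := hf p r h
    simp only [f']; omega
  have hlc' : Compat f' l := hlc.imp fun h hadj => by
    have := h hadj
    simp only [f']; omega
  obtain ⟨m', h1, h2, h3⟩ := conj_le g hg (∑ p, (g p - f' p)).toNat f' hf'
    (fun p => by
      have h1 := hNp p
      have h2 := neg_abs_le (g p - f p)
      have h3 := abs_nonneg (g p - f p)
      simp only [f']; omega)
    (fun p => by have := hpar p; simp only [f']; omega) (Int.self_le_toNat _) l hl hl' hlc'
  have hp : m'.Perm m := (List.perm_ext_iff_of_nodup (h1.nodup_iff.1 hl) hm).2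
    fun p => ⟨fun _ => hm' p, fun _ => h1.mem_iff.1 (hl' p)⟩
  rw [← togProd_uniq g m' m hp h2 hmc]
  exact h3

theorem map_tog {Q : Type} [PartialOrder Q] (e : P ≃o Q) (p : P) (I : LowerSet P) :
    LowerSet.map e (tog p I) = tog (e p) (LowerSet.map e I) := by
  ext x
  change x ∈ LowerSet.map e (tog p I) ↔ x ∈ tog (e p) (LowerSet.map e I)
  obtain ⟨x, rfl⟩ := e.surjective x
  have hmem : ∀ (J : LowerSet P) (y : P), e y ∈ LowerSet.map e J ↔ y ∈ J := by
    intro J y; rw [LowerSet.mem_map]; simp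
  rw [hmem, mem_tog, mem_tog]
  simp only [hmem, ne_eq, e.injective.eq_iff, e.surjective.forall, e.surjective.exists,
    e.lt_iff_lt]

theorem map_togProd {Q : Type} [PartialOrder Q] (e : P ≃o Q) (l : List P) (I : LowerSet P) :
    LowerSet.map e (togProd l I) = togProd (l.map e) (LowerSet.map e I) := by
  induction l with
  | nil => simp [togProd_nil]
  | cons a l ih =>
    rw [List.map_cons, togProd_cons, togProd_cons, Equiv.Perm.mul_apply, Equiv.Perm.mul_apply,
      togP_apply, togP_apply, map_tog, ih]

end Toggle

/-! ### Encoding increasing tableaux as order ideals -/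

section Encode

theorem mem_rect {a b i j : ℕ} : (i, j) ∈ rectCells a b ↔ i < a ∧ j < b := by
  simp [rectCells]

theorem inc_row {a b q : ℕ} {T : ℕ × ℕ → ℕ} (hT : T ∈ IncTabSet a b q) {i j : ℕ} (hi : i < a)
    (d : ℕ) (h : j + d < b) : T (i, j) + d ≤ T (i, j + d) := by
  induction d with
  | zero => simp
  | succ d ih =>
    have h1 := ih (by omega)
    have h2 := hT.1.2.1 (i, j + d) (mem_rect.2 ⟨hi, by omega⟩) (i, j + (d + 1))
      (mem_rect.2 ⟨hi, by omega⟩) rfl (by change j + d < j + (d + 1); omega)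
    omega

theorem inc_col {a b q : ℕ} {T : ℕ × ℕ → ℕ} (hT : T ∈ IncTabSet a b q) {i j : ℕ} (hj : j < b)
    (d : ℕ) (h : i + d < a) : T (i, j) + d ≤ T (i + d, j) := by
  induction d with
  | zero => simp
  | succ d ih =>
    have h1 := ih (by omega)
    have h2 := hT.1.2.2 (i + d, j) (mem_rect.2 ⟨by omega, hj⟩) (i + (d + 1), j)
      (mem_rect.2 ⟨by omega, hj⟩) rfl (by change i + d < i + (d + 1); omega)
    omega

theorem inc_le {a b q : ℕ} {T : ℕ × ℕ → ℕ} (hT : T ∈ IncTabSet a b q) {i j i' j' : ℕ}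
    (hi : i ≤ i') (hi' : i' < a) (hj : j ≤ j') (hj' : j' < b) :
    T (i, j) + i' + j' ≤ T (i', j') + i + j := by
  have h1 := inc_row hT (i := i) (j := j) (by omega) (j' - j) (by omega)
  have h2 := inc_col hT (i := i) (j := j') (by omega) (i' - i) (by omega)
  rw [show j + (j' - j) = j' by omega] at h1
  rw [show i + (i' - i) = i' by omega] at h2
  omega

theorem inc_low {a b q : ℕ} {T : ℕ × ℕ → ℕ} (hT : T ∈ IncTabSet a b q) {i j : ℕ}
    (hi : i < a) (hj : j < b) : i + j + 1 ≤ T (i, j) := by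
  have h1 := inc_le hT (Nat.zero_le i) hi (Nat.zero_le j) hj
  have h2 := hT.1.1 (0, 0) (mem_rect.2 ⟨by omega, by omega⟩)
  omega

theorem inc_up {a b c q : ℕ} (hq : q + 1 = a + b + c) {T : ℕ × ℕ → ℕ}
    (hT : T ∈ IncTabSet a b q) {i j : ℕ}
    (hi : i < a) (hj : j < b) : T (i, j) ≤ c + i + j + 1 := by
  have h1 := inc_le hT (show i ≤ a - 1 by omega) (by omega) (show j ≤ b - 1 by omega) (by omega)
  have h2 := hT.1.1 (a - 1, b - 1) (mem_rect.2 ⟨by omega, by omega⟩)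
  omega

/-- The order ideal attached to a tableau. -/
def enc (a b c : ℕ) (T : ℕ × ℕ → ℕ) : LowerSet (Fin a × Fin b × Fin c) where
  carrier := {p | ∀ p' ≤ p, T (p'.1, p'.2.1) + p'.2.2 ≤ c + p'.1 + p'.2.1}
  lower' := fun _ _ hyx hx p' hp' => hx p' (hp'.trans hyx)

theorem mem_enc {a b q : ℕ} (c : ℕ) {T : ℕ × ℕ → ℕ} (hT : T ∈ IncTabSet a b q)
    (i : Fin a) (j : Fin b) (k : Fin c) :
    (i, j, k) ∈ enc a b c T ↔ T (i, j) + k ≤ c + i + j := by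
  constructor
  · intro h
    exact h (i, j, k) le_rfl
  · rintro h ⟨i', j', k'⟩ ⟨h1, h2, h3⟩
    simp only [Fin.le_def] at h1 h2 h3 ⊢
    have := inc_le hT h1 i.2 h2 j.2
    omega

theorem enc_injOn {a b c q : ℕ} (hq : q + 1 = a + b + c) :
    Set.InjOn (enc a b c) (IncTabSet a b q) := by
  have key : ∀ T ∈ IncTabSet a b q, ∀ S ∈ IncTabSet a b q, enc a b c T = enc a b c S →
      ∀ i j, i < a → j < b → ¬ T (i, j) < S (i, j) := by
    intro T hT S hS h i j hi hj hlt
    have h1 := inc_low hT hi hj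
    have h2 := inc_up hq hS hi hj
    have hk : c + i + j - T (i, j) < c := by omega
    have h3 := mem_enc c hT ⟨i, hi⟩ ⟨j, hj⟩ ⟨_, hk⟩
    have h4 := mem_enc c hS ⟨i, hi⟩ ⟨j, hj⟩ ⟨_, hk⟩
    rw [h, h4] at h3
    simp only at h3
    omega
  intro T hT S hS h
  funext ⟨i, j⟩
  by_cases hc : (i, j) ∈ rectCells a b
  · obtain ⟨hi, hj⟩ := mem_rect.1 hc
    have h1 := key T hT S hS h i j hi hj
    have h2 := key S hS T hT h.symm i j hi hj
    omega
  · rw [hT.2 _ hc, hS.2 _ hc]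

theorem enc_surj {a b c q : ℕ} (hq : q + 1 = a + b + c) (I : LowerSet (Fin a × Fin b × Fin c)) :
    ∃ T ∈ IncTabSet a b q, enc a b c T = I := by
  have hex : ∀ (i : Fin a) (j : Fin b), ∃ n, n ≤ c ∧ ∀ k : Fin c, (i, j, k) ∈ I ↔ (k : ℕ) < n := by
    intro i j
    have hP : ∃ n, ∀ h : n < c, (i, j, (⟨n, h⟩ : Fin c)) ∉ I := ⟨c, fun h => absurd h (lt_irrefl c)⟩
    refine ⟨Nat.find hP, Nat.find_min' hP fun h => absurd h (lt_irrefl c), fun k => ?_⟩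
    constructor
    · intro hk
      by_contra hcon
      have h1 : Nat.find hP < c := by have := k.2; omega
      apply Nat.find_spec hP h1
      exact I.lower (show (i, j, (⟨_, h1⟩ : Fin c)) ≤ (i, j, k) from
        ⟨le_rfl, le_rfl, by simpa [Fin.le_def] using hcon⟩) hk
    · intro hk
      have := Nat.find_min hP hk
      push Not at this
      obtain ⟨_, h⟩ := this
      exact h
  choose n hn hnI using hex
  have hanti : ∀ i i' j j', i ≤ i' → j ≤ j' → n i' j' ≤ n i j := by
    intro i i' j j' hi hj
    by_contra hcon
    have hlt : n i j < c := by have := hn i' j'; omega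
    have h1 : (i', j', (⟨n i j, hlt⟩ : Fin c)) ∈ I := (hnI _ _ _).2 (by simp only; omega)
    have h2 : (i, j, (⟨n i j, hlt⟩ : Fin c)) ∈ I := 
      I.lower (show (i, j, (⟨n i j, hlt⟩ : Fin c)) ≤ (i', j', ⟨n i j, hlt⟩) from ⟨hi, hj, le_rfl⟩) h1
    have := (hnI _ _ _).1 h2
    simp only at this
    omega
  let T : ℕ × ℕ → ℕ := fun p =>
    if h : p.1 < a ∧ p.2 < b then p.1 + p.2 + 1 + c - n ⟨p.1, h.1⟩ ⟨p.2, h.2⟩ else 0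
  have hTv : ∀ i j (hi : i < a) (hj : j < b),
      T (i, j) = i + j + 1 + c - n ⟨i, hi⟩ ⟨j, hj⟩ := by
    intro i j hi hj
    simp [T, hi, hj]
  have hT : T ∈ IncTabSet a b q := by
    refine ⟨⟨?_, ?_, ?_⟩, ?_⟩
    · rintro ⟨i, j⟩ h
      obtain ⟨hi, hj⟩ := mem_rect.1 h
      rw [hTv i j hi hj]
      have := hn ⟨i, hi⟩ ⟨j, hj⟩
      omega
    · rintro ⟨i, j⟩ h ⟨i', j'⟩ h' h1 h2
      obtain ⟨hi, hj⟩ := mem_rect.1 h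
      obtain ⟨hi', hj'⟩ := mem_rect.1 h'
      rw [hTv i j hi hj, hTv i' j' hi' hj']
      simp only at h1 h2
      have e1 := hn ⟨i, hi⟩ ⟨j, hj⟩
      have e2 := hn ⟨i', hi'⟩ ⟨j', hj'⟩
      have := hanti ⟨i, hi⟩ ⟨i', hi'⟩ ⟨j, hj⟩ ⟨j', hj'⟩ (by simp [Fin.le_def]; omega)
        (by simp [Fin.le_def]; omega)
      omega
    · rintro ⟨i, j⟩ h ⟨i', j'⟩ h' h1 h2
      obtain ⟨hi, hj⟩ := mem_rect.1 h
      obtain ⟨hi', hj'⟩ := mem_rect.1 h'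
      rw [hTv i j hi hj, hTv i' j' hi' hj']
      simp only at h1 h2
      have e1 := hn ⟨i, hi⟩ ⟨j, hj⟩
      have e2 := hn ⟨i', hi'⟩ ⟨j', hj'⟩
      have := hanti ⟨i, hi⟩ ⟨i', hi'⟩ ⟨j, hj⟩ ⟨j', hj'⟩ (by simp [Fin.le_def]; omega)
        (by simp [Fin.le_def]; omega)
      omega
    · rintro ⟨i, j⟩ h
      rw [mem_rect] at h
      simp [T, h]
  refine ⟨T, hT, ?_⟩
  ext ⟨i, j, k⟩
  change (i, j, k) ∈ enc a b c T ↔ (i, j, k) ∈ I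
  rw [mem_enc c hT, hTv _ _ i.2 j.2, hnI]
  have := hn i j
  simp only [Fin.eta]
  omega

/-! ### K-Bender-Knuth moves are level toggles -/

theorem kbk_cases (μ : Finset (ℕ × ℕ)) (m : ℕ) (T : ℕ × ℕ → ℕ) (x : ℕ × ℕ) (hx : x ∈ μ) :
    (T x = m ∧ (¬ ∃ d ∈ μ, incAdj x d ∧ T d = m + 1) ∧ kbkMap μ m T x = m + 1) ∨
    (T x = m ∧ (∃ d ∈ μ, incAdj x d ∧ T d = m + 1) ∧ kbkMap μ m T x = m) ∨
    (T x = m + 1 ∧ (¬ ∃ d ∈ μ, incAdj x d ∧ T d = m) ∧ kbkMap μ m T x = m) ∨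
    (T x = m + 1 ∧ (∃ d ∈ μ, incAdj x d ∧ T d = m) ∧ kbkMap μ m T x = m + 1) ∨
    (T x ≠ m ∧ T x ≠ m + 1 ∧ kbkMap μ m T x = T x) := by
  unfold kbkMap
  by_cases h1 : T x = m
  · by_cases h2 : ∃ d ∈ μ, incAdj x d ∧ T d = m + 1
    · right; left
      refine ⟨h1, h2, ?_⟩
      rw [if_neg (fun h => h.2.2 h2), if_neg (fun h => by have := h.2.1; omega), h1]
    · left
      exact ⟨h1, h2, if_pos ⟨hx, h1, h2⟩⟩
  · by_cases h3 : T x = m + 1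
    · by_cases h2 : ∃ d ∈ μ, incAdj x d ∧ T d = m
      · right; right; right; left
        refine ⟨h3, h2, ?_⟩
        rw [if_neg (by tauto), if_neg (fun h => h.2.2 h2), h3]
      · right; right; left
        refine ⟨h3, h2, ?_⟩
        rw [if_neg (by tauto), if_pos ⟨hx, h3, h2⟩]
    · right; right; right; right
      refine ⟨h1, h3, ?_⟩
      rw [if_neg (by tauto), if_neg (by tauto)]

theorem kbk_lt (μ : Finset (ℕ × ℕ)) (m : ℕ) (T : ℕ × ℕ → ℕ) (x y : ℕ × ℕ) (hx : x ∈ μ)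
    (hy : y ∈ μ) (hlt : T x < T y) (hadj : T y = T x + 1 → incAdj x y ∧ incAdj y x) :
    kbkMap μ m T x < kbkMap μ m T y := by
  have key : T x = m → T y = m + 1 → (∃ d ∈ μ, incAdj x d ∧ T d = m + 1) ∧
      (∃ d ∈ μ, incAdj y d ∧ T d = m) := by
    intro h1 h2
    obtain ⟨h3, h4⟩ := hadj (by omega)
    exact ⟨⟨y, hy, h3, h2⟩, ⟨x, hx, h4, h1⟩⟩
  rcases kbk_cases μ m T x hx with h | h | h | h | h <;>
  rcases kbk_cases μ m T y hy with h' | h' | h' | h' | h' <;>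
  first
  | omega
  | (exact absurd (key h.1 h'.1).1 h.2.1)
  | (exact absurd (key h.1 h'.1).2 h'.2.1)

theorem kbk_mem {a b q m : ℕ} (hm : 1 ≤ m) (hmq : m + 1 ≤ q) {T : ℕ × ℕ → ℕ}
    (hT : T ∈ IncTabSet a b q) : kbkMap (rectCells a b) m T ∈ IncTabSet a b q := by
  refine ⟨⟨?_, ?_, ?_⟩, ?_⟩
  · intro x hx
    have := hT.1.1 x hx
    rcases kbk_cases (rectCells a b) m T x hx with h | h | h | h | h <;> omega
  · rintro ⟨i, j⟩ h ⟨i', j'⟩ h' h1 h2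
    refine kbk_lt _ _ _ _ _ h h' (hT.1.2.1 _ h _ h' h1 h2) ?_
    intro hs
    obtain ⟨hi, hj⟩ := mem_rect.1 h
    obtain ⟨hi', hj'⟩ := mem_rect.1 h'
    simp only at h1 h2
    have := inc_le hT (show i ≤ i' by omega) hi' (show j ≤ j' by omega) hj'
    simp only [incAdj]
    omega
  · rintro ⟨i, j⟩ h ⟨i', j'⟩ h' h1 h2
    refine kbk_lt _ _ _ _ _ h h' (hT.1.2.2 _ h _ h' h1 h2) ?_
    intro hs
    obtain ⟨hi, hj⟩ := mem_rect.1 h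
    obtain ⟨hi', hj'⟩ := mem_rect.1 h'
    simp only at h1 h2
    have := inc_le hT (show i ≤ i' by omega) hi' (show j ≤ j' by omega) hj'
    simp only [incAdj]
    omega
  · intro x hx
    unfold kbkMap
    rw [if_neg (by tauto), if_neg (by tauto)]
    exact hT.2 x hx

theorem enc_all_lt {a b c q : ℕ} (hq : q + 1 = a + b + c) {T : ℕ × ℕ → ℕ}
    (hT : T ∈ IncTabSet a b q) (i : Fin a) (j : Fin b) (k : Fin c) (m : ℕ)
    (hm : m + k = c + i + j) :
    (∀ y, y < (i, j, k) → y ∈ enc a b c T) ↔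
      (T (i, j) ≤ m + 1 ∧ ∀ d ∈ rectCells a b, incAdj (i, j) d → T d < T (i, j) → T d < m) := by
  constructor
  · intro h
    constructor
    · by_cases hk : (k : ℕ) = 0
      · have := inc_up hq hT i.2 j.2
        omega
      · have h1 := h (i, j, ⟨k - 1, by omega⟩) (by simp [Prod.lt_iff, Fin.lt_def]; omega)
        rw [mem_enc c hT] at h1
        simp only at h1
        omega
    · rintro ⟨i', j'⟩ hd hadj hlt
      obtain ⟨hi', hj'⟩ := mem_rect.1 hd
      simp only [incAdj] at hadj
      rcases hadj with ⟨h1, h2 | h2⟩ | ⟨h1, h2 | h2⟩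
      · have := inc_le hT h1.le hi' (show (j : ℕ) ≤ j' by omega) hj'
        omega
      · have h3 := h (⟨i', hi'⟩, ⟨j', hj'⟩, k) (by simp [Prod.lt_iff, Fin.lt_def, Fin.le_def]; omega)
        rw [mem_enc c hT] at h3
        simp only at h3
        omega
      · have := inc_le hT (show (i : ℕ) ≤ i' by omega) hi' h1.le hj'
        omega
      · have h3 := h (⟨i', hi'⟩, ⟨j', hj'⟩, k) (by simp [Prod.lt_iff, Fin.lt_def, Fin.le_def]; omega)
        rw [mem_enc c hT] at h3
        simp only at h3
        omega
  · rintro ⟨h0, h⟩ ⟨i', j', k'⟩ hy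
    rw [mem_enc c hT]
    simp only [Prod.lt_iff, Prod.mk_le_mk, Fin.lt_def, Fin.le_def] at hy
    have hle : (i' : ℕ) ≤ i ∧ (j' : ℕ) ≤ j ∧ (k' : ℕ) ≤ k := by omega
    by_cases h1 : (i' : ℕ) < i
    · have h2 := inc_le hT (show (i' : ℕ) ≤ i - 1 by omega) (by omega) hle.2.1 j.2
      have h3 := inc_le hT (show (i : ℕ) - 1 ≤ i by omega) i.2 (le_refl (j : ℕ)) j.2
      have h4 := h (i - 1, j) (mem_rect.2 ⟨by omega, j.2⟩) (Or.inr ⟨rfl, by simp only; omega⟩) (by omega)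
      omega
    · by_cases h1' : (j' : ℕ) < j
      · have h2 := inc_le hT hle.1 i.2 (show (j' : ℕ) ≤ j - 1 by omega) (by omega)
        have h3 := inc_le hT (le_refl (i : ℕ)) i.2 (show (j : ℕ) - 1 ≤ j by omega) j.2
        have h4 := h (i, j - 1) (mem_rect.2 ⟨i.2, by omega⟩) (Or.inl ⟨rfl, by simp only; omega⟩)
          (by omega)
        omega
      · have h2 := inc_le hT hle.1 i.2 hle.2.1 j.2
        omega

theorem enc_ex_gt {a b c q : ℕ} {T : ℕ × ℕ → ℕ}
    (hT : T ∈ IncTabSet a b q) (i : Fin a) (j : Fin b) (k : Fin c) (m : ℕ)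
    (hm : m + k = c + i + j) :
    (∃ y, (i, j, k) < y ∧ y ∈ enc a b c T) ↔
      (T (i, j) < m ∨ ∃ d ∈ rectCells a b, incAdj (i, j) d ∧ T (i, j) < T d ∧ T d ≤ m + 1) := by
  constructor
  · rintro ⟨⟨i', j', k'⟩, hy, hmem⟩
    rw [mem_enc c hT] at hmem
    simp only [Prod.lt_iff, Prod.mk_le_mk, Fin.lt_def, Fin.le_def] at hy
    have hle : (i : ℕ) ≤ i' ∧ (j : ℕ) ≤ j' ∧ (k : ℕ) ≤ k' := by omega
    by_cases h1 : (i : ℕ) < i'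
    · have h2 := inc_le hT (show (i : ℕ) + 1 ≤ i' by omega) i'.2 hle.2.1 j'.2
      have h3 := inc_le hT (show (i : ℕ) ≤ i + 1 by omega) (by omega) (le_refl (j : ℕ)) j.2
      exact Or.inr ⟨(i + 1, j), mem_rect.2 ⟨by omega, j.2⟩, Or.inr ⟨rfl, Or.inl rfl⟩,
        by omega, by omega⟩
    · by_cases h1' : (j : ℕ) < j'
      · have h2 := inc_le hT hle.1 i'.2 (show (j : ℕ) + 1 ≤ j' by omega) j'.2
        have h3 := inc_le hT (le_refl (i : ℕ)) i.2 (show (j : ℕ) ≤ j + 1 by omega) (by omega)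
        exact Or.inr ⟨(i, j + 1), mem_rect.2 ⟨i.2, by omega⟩, Or.inl ⟨rfl, Or.inl rfl⟩,
          by omega, by omega⟩
      · left
        have h2 := inc_le hT hle.1 i'.2 hle.2.1 j'.2
        omega
  · rintro (h | ⟨⟨i', j'⟩, hd, hadj, hlt, hle⟩)
    · have h1 := inc_low hT i.2 j.2
      refine ⟨(i, j, ⟨k + 1, by omega⟩), by simp [Prod.lt_iff, Fin.lt_def], ?_⟩
      rw [mem_enc c hT]
      simp only
      omega
    · obtain ⟨hi', hj'⟩ := mem_rect.1 hd
      have hlt' : (i : ℕ) + 1 = i' ∧ (j : ℕ) = j' ∨ (i : ℕ) = i' ∧ (j : ℕ) + 1 = j' := by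
        simp only [incAdj] at hadj
        rcases hadj with ⟨h1, h2 | h2⟩ | ⟨h1, h2 | h2⟩
        · omega
        · have := inc_le hT h1.ge i.2 (show j' ≤ (j : ℕ) by omega) j.2
          omega
        · omega
        · have := inc_le hT (show i' ≤ (i : ℕ) by omega) i.2 h1.ge j.2
          omega
      refine ⟨(⟨i', hi'⟩, ⟨j', hj'⟩, k),
        by simp [Prod.lt_iff, Fin.lt_def, Fin.le_def]; omega, ?_⟩
      rw [mem_enc c hT]
      simp only
      omega

theorem enc_kbk {a b c q m : ℕ} (hq : q + 1 = a + b + c) (hm : 1 ≤ m) (hmq : m + 1 ≤ q)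
    {T : ℕ × ℕ → ℕ} (hT : T ∈ IncTabSet a b q) (i : Fin a) (j : Fin b) (k : Fin c) :
    (i, j, k) ∈ enc a b c (kbkMap (rectCells a b) m T) ↔
      if m + k = c + i + j then (i, j, k) ∈ tog (i, j, k) (enc a b c T)
      else (i, j, k) ∈ enc a b c T := by
  have hx : ((i : ℕ), (j : ℕ)) ∈ rectCells a b := mem_rect.2 ⟨i.2, j.2⟩
  rw [mem_enc c (kbk_mem hm hmq hT)]
  have hc := kbk_cases (rectCells a b) m T _ hx
  split_ifs with h
  · rw [mem_tog_self, enc_all_lt hq hT i j k m h, enc_ex_gt hT i j k m h, mem_enc c hT]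
    have hL : kbkMap (rectCells a b) m T (i, j) + k ≤ c + i + j ↔
        kbkMap (rectCells a b) m T (i, j) ≤ m := by omega
    have hR : T (i, j) + k ≤ c + i + j ↔ T (i, j) ≤ m := by omega
    rw [hL, hR]
    generalize kbkMap (rectCells a b) m T (i, j) = K at *
    rcases hc with ⟨h1, h2, h3⟩ | ⟨h1, h2, h3⟩ | ⟨h1, h2, h3⟩ | ⟨h1, h2, h3⟩ | ⟨h1, h2, h3⟩
    · refine iff_of_false (by omega) ?_
      rintro ⟨-, h4 | h4 | ⟨d, hd, hadj, h5, h6⟩⟩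
      · omega
      · omega
      · exact h2 ⟨d, hd, hadj, by omega⟩
    · refine iff_of_true (by omega) ⟨⟨by omega, fun d _ _ h => by omega⟩, Or.inr (Or.inr ?_)⟩
      obtain ⟨d, hd, hadj, h5⟩ := h2
      exact ⟨d, hd, hadj, by omega, by omega⟩
    · refine iff_of_true (by omega) ⟨⟨by omega, fun d hd hadj h => ?_⟩, Or.inl (by omega)⟩
      by_contra hcon
      exact h2 ⟨d, hd, hadj, by omega⟩
    · refine iff_of_false (by omega) ?_
      rintro ⟨⟨-, h4⟩, -⟩
      obtain ⟨d, hd, hadj, h5⟩ := h2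
      have := h4 d hd hadj (by omega)
      omega
    · by_cases h4 : T (i, j) < m
      · exact iff_of_true (by omega) ⟨⟨by omega, fun d _ _ h => by omega⟩, Or.inr (Or.inl h4)⟩
      · refine iff_of_false (by omega) ?_
        rintro ⟨⟨h5, -⟩, -⟩
        omega
  · rw [mem_enc c hT]
    rcases hc with ⟨h1, -, h3⟩ | ⟨h1, -, h3⟩ | ⟨h1, -, h3⟩ | ⟨h1, -, h3⟩ | ⟨-, -, h3⟩ <;> omega

/-- The height function of the box. -/
def boxHt (a b c : ℕ) (p : Fin a × Fin b × Fin c) : ℤ := (p.2.2 : ℤ) - (p.1 : ℤ) - (p.2.1 : ℤ)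

theorem fin_covBy {n : ℕ} {x y : Fin n} (h : x ⋖ y) : (y : ℕ) = x + 1 := by
  have h1 : (x : ℕ) < y := h.1
  by_contra hcon
  exact h.2 (c := ⟨x + 1, by omega⟩) (by simp [Fin.lt_def]) (by simp only [Fin.lt_def]; omega)

theorem boxHt_isHeight (a b c : ℕ) : IsHeight (boxHt a b c) := by
  rintro ⟨i, j, k⟩ ⟨i', j', k'⟩ h
  simp only [Prod.mk_covBy_mk_iff, Prod.mk.injEq] at h
  simp only [boxHt]
  rcases h with ⟨h, rfl, rfl⟩ | ⟨⟨h, rfl⟩ | ⟨h, rfl⟩, rfl⟩ <;> have := fin_covBy h <;> omega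

theorem promo_prefix {a b c q : ℕ} (hq : q + 1 = a + b + c) (n : ℕ) (hn : n + 1 ≤ q) :
    ∃ L : List (Fin a × Fin b × Fin c), L.Nodup ∧
      (∀ p, p ∈ L ↔ c + p.1 + p.2.1 ≤ n + p.2.2) ∧ Compat (boxHt a b c) L ∧
      ∀ T ∈ IncTabSet a b q,
        (List.range n).foldl (fun S k => kbkMap (rectCells a b) (k + 1) S) T ∈ IncTabSet a b q ∧
        enc a b c ((List.range n).foldl (fun S k => kbkMap (rectCells a b) (k + 1) S) T) =
          togProd L (enc a b c T) := by
  induction n with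
  | zero =>
    refine ⟨[], by simp, ?_, List.Pairwise.nil, ?_⟩
    · rintro ⟨i, j, k⟩
      simp
      omega
    · intro T hT
      simp [togProd_nil, hT]
  | succ n ih =>
    obtain ⟨L, h1, h2, h3, h4⟩ := ih (by omega)
    set M : List (Fin a × Fin b × Fin c) :=
      (Finset.univ.filter fun p : Fin a × Fin b × Fin c => n + 1 + p.2.2 = c + p.1 + p.2.1).toList
      with hM
    have hMm : ∀ p, p ∈ M ↔ n + 1 + (p.2.2 : ℕ) = c + p.1 + p.2.1 := by
      intro p; simp [hM]
    have hMn : M.Nodup := Finset.nodup_toList _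
    have hMadj : ∀ x ∈ M, ∀ y ∈ M, ¬ hAdj x y := by
      intro x hx y hy hadj
      have := (boxHt_isHeight a b c).adj hadj
      rw [hMm] at hx hy
      simp only [boxHt] at this
      omega
    refine ⟨M ++ L, ?_, ?_, ?_, ?_⟩
    · rw [List.nodup_append]
      refine ⟨hMn, h1, ?_⟩
      rintro x hx y hy rfl
      rw [hMm] at hx
      rw [h2] at hy
      omega
    · intro p
      rw [List.mem_append, hMm, h2]
      omega
    · unfold Compat
      rw [List.pairwise_append]
      refine ⟨?_, h3, ?_⟩
      · exact List.Pairwise.imp_of_mem (R := fun _ _ => True)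
          (fun hx hy _ hadj => absurd hadj (hMadj _ hx _ hy)) (List.pairwise_of_forall (by simp))
      · intro x hx y hy _
        rw [hMm] at hx
        rw [h2] at hy
        simp only [boxHt]
        omega
    · intro T hT
      obtain ⟨h5, h6⟩ := h4 T hT
      rw [List.range_succ, List.foldl_append, List.foldl_cons, List.foldl_nil]
      refine ⟨kbk_mem (by omega) (by omega) h5, ?_⟩
      rw [togProd_append, Equiv.Perm.mul_apply, ← h6]
      ext ⟨i, j, k⟩
      change (i, j, k) ∈ enc a b c _ ↔ (i, j, k) ∈ togProd M _
      rw [enc_kbk hq (by omega) (by omega) h5]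
      split_ifs with h
      · exact (mem_togProd_mem M hMn hMadj _ ((hMm _).2 h) _).symm
      · exact (mem_togProd_notMem M _ (fun h' => h ((hMm _).1 h')) _).symm

theorem promo_enc {a b c q : ℕ} (hq : q + 1 = a + b + c) (ha : 0 < a) (hb : 0 < b) (hc : 0 < c) :
    ∃ L : List (Fin a × Fin b × Fin c), L.Nodup ∧ (∀ p, p ∈ L) ∧ Compat (boxHt a b c) L ∧
      ∀ T ∈ IncTabSet a b q, kPromo (rectCells a b) q T ∈ IncTabSet a b q ∧
        enc a b c (kPromo (rectCells a b) q T) = togProd L (enc a b c T) := by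
  obtain ⟨L, h1, h2, h3, h4⟩ := promo_prefix hq (q - 1) (by omega)
  refine ⟨L, h1, ?_, h3, h4⟩
  rintro ⟨i, j, k⟩
  rw [h2]
  simp only
  omega

theorem transfer {a b c a' b' c' q : ℕ} (hq : q + 1 = a + b + c) (ha : 0 < a) (hb : 0 < b)
    (hc : 0 < c) (hq' : q + 1 = a' + b' + c') (ha' : 0 < a') (hb' : 0 < b') (hc' : 0 < c')
    (e : (Fin a × Fin b × Fin c) ≃o (Fin a' × Fin b' × Fin c'))
    (hpar : ∀ p, 2 ∣ boxHt a' b' c' (e p) - boxHt a b c p) :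
    ∃ φ : (ℕ × ℕ → ℕ) → (ℕ × ℕ → ℕ),
      Set.BijOn φ (IncTabSet a b q) (IncTabSet a' b' q) ∧
      ∀ T ∈ IncTabSet a b q,
        φ (kPromo (rectCells a b) q T) = kPromo (rectCells a' b') q (φ T) := by
  obtain ⟨L, h1, h2, h3, h4⟩ := promo_enc hq ha hb hc
  obtain ⟨M, k1, k2, k3, k4⟩ := promo_enc hq' ha' hb' hc'
  have hcov : ∀ x y, hAdj (e x) (e y) ↔ hAdj x y := by
    intro x y
    simp only [hAdj, apply_covBy_apply_iff]
  have hconj : IsConj (togProd (L.map e)) (togProd M) := by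
    refine conj_main (fun p => boxHt a b c (e.symm p)) (boxHt a' b' c') ?_ (boxHt_isHeight _ _ _)
      ?_ _ _ (h1.map e.injective) k1 ?_ k2 ?_ k3
    · intro p r h
      exact boxHt_isHeight a b c _ _ ((apply_covBy_apply_iff e.symm).2 h)
    · intro p
      simpa using hpar (e.symm p)
    · intro p
      exact List.mem_map.2 ⟨e.symm p, h2 _, by simp⟩
    · unfold Compat
      rw [List.pairwise_map]
      refine h3.imp ?_
      intro x y hxy hadj
      simpa using hxy ((hcov x y).1 hadj)
  obtain ⟨σ, hσ⟩ := isConj_iff.1 hconj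
  have hσ' : ∀ I, σ (togProd (L.map e) I) = togProd M (σ I) := by
    intro I
    rw [← hσ]
    simp [Equiv.Perm.mul_apply]
  choose dec hdec1 hdec2 using fun I => enc_surj hq' I
  have hinj := enc_injOn hq
  have hinj' := enc_injOn hq'
  refine ⟨fun T => dec (σ (LowerSet.map e (enc a b c T))), ⟨?_, ?_, ?_⟩, ?_⟩
  · intro T _
    exact hdec1 _
  · intro T hT S hS h
    apply hinj hT hS
    have h' := congrArg (enc a' b' c') h
    simp only [hdec2] at h'
    exact (LowerSet.map e).injective (σ.injective h')
  · intro S hS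
    obtain ⟨T, hT, hTe⟩ := enc_surj hq ((LowerSet.map e).symm (σ.symm (enc a' b' c' S)))
    refine ⟨T, hT, hinj' (hdec1 _) hS ?_⟩
    rw [hdec2, hTe, OrderIso.apply_symm_apply, Equiv.apply_symm_apply]
  · intro T hT
    apply hinj' (hdec1 _) (k4 _ (hdec1 _)).1
    rw [hdec2, (k4 _ (hdec1 _)).2, hdec2, (h4 T hT).2, map_togProd, hσ']

end Encode

/-- Corollary 4.7: with `q = a + b + c - 1`, there are K-promotion-equivariant
bijections between `Inc^q(a×b)`, `Inc^q(a×c)` and `Inc^q(b×c)`. -/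
theorem trifold_symmetry (a b c : ℕ) (ha : 0 < a) (hb : 0 < b) (hc : 0 < c) :
    ∃ φ ψ : (ℕ × ℕ → ℕ) → (ℕ × ℕ → ℕ),
      Set.BijOn φ (IncTabSet a b (a + b + c - 1)) (IncTabSet a c (a + b + c - 1)) ∧
      Set.BijOn ψ (IncTabSet a b (a + b + c - 1)) (IncTabSet b c (a + b + c - 1)) ∧
      (∀ T ∈ IncTabSet a b (a + b + c - 1),
        φ (kPromo (rectCells a b) (a + b + c - 1) T) =
          kPromo (rectCells a c) (a + b + c - 1) (φ T)) ∧
      (∀ T ∈ IncTabSet a b (a + b + c - 1),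
        ψ (kPromo (rectCells a b) (a + b + c - 1) T) =
          kPromo (rectCells b c) (a + b + c - 1) (ψ T)) := by
  obtain ⟨φ, hφ, hφ'⟩ := transfer (a := a) (b := b) (c := c) (a' := a) (b' := c) (c' := b)
    (q := a + b + c - 1) (by omega) ha hb hc (by omega) ha hc hb
    { toFun := fun p => (p.1, p.2.2, p.2.1)
      invFun := fun p => (p.1, p.2.2, p.2.1)
      left_inv := fun _ => rfl
      right_inv := fun _ => rfl
      map_rel_iff' := by
        rintro ⟨i, j, k⟩ ⟨i', j', k'⟩
        simp only [Equiv.coe_fn_mk, Prod.mk_le_mk]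
        tauto }
    (by
      rintro ⟨i, j, k⟩
      simp only [boxHt, RelIso.coe_fn_mk, Equiv.coe_fn_mk]
      omega)
  obtain ⟨ψ, hψ, hψ'⟩ := transfer (a := a) (b := b) (c := c) (a' := b) (b' := c) (c' := a)
    (q := a + b + c - 1) (by omega) ha hb hc (by omega) hb hc ha
    { toFun := fun p => (p.2.1, p.2.2, p.1)
      invFun := fun p => (p.2.2, p.1, p.2.1)
      left_inv := fun _ => rfl
      right_inv := fun _ => rfl
      map_rel_iff' := by
        rintro ⟨i, j, k⟩ ⟨i', j', k'⟩
        simp only [Equiv.coe_fn_mk, Prod.mk_le_mk]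
        tauto }
    (by
      rintro ⟨i, j, k⟩
      simp only [boxHt, RelIso.coe_fn_mk, Equiv.coe_fn_mk]
      omega)
  exact ⟨φ, ψ, hφ, hψ, hφ', hψ'⟩
end
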